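/- arXiv:0907.5132 — 3 statements merged into one kernel-verified Lean document; each statement's English description precedes it below -/
import Mathlib

section
/- For any k,l ≥ 2, the language {a^(l^(k^n)) : n ≥ 0} is a nonerasing scattered context language, generated by a grammar with exactly twelve nonterminals and fourteen productions. -/
/-- Symbols of a grammar: nonterminals or terminals. -/
inductive GSym (N T : Type) where
  | nt : N → GSym N T
  | tm : T → GSym N T
  deriving DecidableEq

abbrev Str (N T : Type) := List (GSym N T)

/-- `SCMatch ps u v` : applying the scattered context production with components `ps`
(an ordered list of pairs `(Aᵢ, xᵢ)`) rewrites `u` to `v`. -/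
def SCMatch {N T : Type} : List (N × Str N T) → Str N T → Str N T → Prop
  | [], u, v => u = v
  | (A, x) :: ps, u, v =>
      ∃ u₁ u' v', u = u₁ ++ GSym.nt A :: u' ∧ v = u₁ ++ x ++ v' ∧ SCMatch ps u' v'

/-- A scattered context grammar (with a fixed set of productions, each a nonempty
list of pairs of a nonterminal and its replacement string). -/
structure SCG (N T : Type) where
  prods : List (List (N × Str N T))
  start : N
  nonempty_prods : ∀ p ∈ prods, p ≠ []

def SCG.Step {N T : Type} (g : SCG N T) (u v : Str N T) : Prop :=
  ∃ p ∈ g.prods, SCMatch p u v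

def SCG.language {N T : Type} (g : SCG N T) : Set (List T) :=
  {w | Relation.ReflTransGen g.Step [GSym.nt g.start] (w.map GSym.tm)}


def SCG.Nonerasing {N T : Type} (g : SCG N T) : Prop :=
  ∀ p ∈ g.prods, ∀ q ∈ p, q.2 ≠ []

/-- Nonterminals of the grammar. -/
inductive NT where
  | S | C | B | K | E | D | A | H | F | Z | U | V
  deriving DecidableEq

instance : Fintype NT :=
  ⟨{.S, .C, .B, .K, .E, .D, .A, .H, .F, .Z, .U, .V}, fun x => by cases x <;> decide⟩

namespace PowerTower

open Relation List

section Abstraction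

variable {N : Type}

/-- The nonterminals of a string, in order. -/
def erase : Str N Unit → List N
  | [] => []
  | GSym.nt A :: u => A :: erase u
  | GSym.tm _ :: u => erase u

/-- The number of terminals of a string. -/
def cnt : Str N Unit → ℕ
  | [] => 0
  | GSym.nt _ :: u => cnt u
  | GSym.tm _ :: u => cnt u + 1

/-- A component `(A, x, c)` rewrites `A` to `x` followed by `c` terminals. -/
abbrev Comp (N : Type) := N × List N × ℕ

def Comp.toPair (q : Comp N) : N × Str N Unit :=
  (q.1, q.2.1.map GSym.nt ++ replicate q.2.2 (GSym.tm ()))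

/-- `SCMatch` with the terminals left out. -/
def EMatch : List (Comp N) → List N → List N → Prop
  | [], u, v => u = v
  | (A, x, _) :: ps, u, v =>
      ∃ u₁ u' v', u = u₁ ++ A :: u' ∧ v = u₁ ++ x ++ v' ∧ EMatch ps u' v'

/-- The number of terminals introduced by a production. -/
def gain (ps : List (Comp N)) : ℕ := (ps.map fun q => q.2.2).sum

def EStep (R : List (List (Comp N))) (a b : List N × ℕ) : Prop :=
  ∃ p ∈ R, EMatch p a.1 b.1 ∧ b.2 = a.2 + gain p

theorem erase_append (u v : Str N Unit) : erase (u ++ v) = erase u ++ erase v := by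
  induction u with
  | nil => rfl
  | cons a u ih => cases a <;> simp [erase, ih]

theorem cnt_append (u v : Str N Unit) : cnt (u ++ v) = cnt u + cnt v := by
  induction u with
  | nil => simp [cnt]
  | cons a u ih => cases a <;> simp [cnt, ih]; omega

theorem erase_map_nt (x : List N) : erase (x.map GSym.nt) = x := by
  induction x with
  | nil => rfl
  | cons a x ih => simp [erase, ih]

theorem cnt_map_nt (x : List N) : cnt (x.map GSym.nt) = 0 := by
  induction x with
  | nil => rfl
  | cons a x ih => simp [cnt, ih]

theorem erase_map_tm (w : List Unit) : erase (w.map (GSym.tm : Unit → GSym N Unit)) = [] := by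
  induction w with
  | nil => rfl
  | cons a x ih => simp [erase, ih]

theorem cnt_map_tm (w : List Unit) : cnt (w.map (GSym.tm : Unit → GSym N Unit)) = w.length := by
  induction w with
  | nil => rfl
  | cons a x ih => simp [cnt, ih]

theorem erase_replacement (x : List N) (c : ℕ) :
    erase (x.map GSym.nt ++ replicate c (GSym.tm ())) = x := by
  have := erase_map_tm (N := N) (replicate c ())
  simp_all [erase_append, erase_map_nt]

theorem cnt_replacement (x : List N) (c : ℕ) :
    cnt (x.map GSym.nt ++ replicate c (GSym.tm ())) = c := by
  have := cnt_map_tm (N := N) (replicate c ())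
  simp_all [cnt_append, cnt_map_nt]

theorem eq_replicate_of_erase_eq_nil {u : Str N Unit} (h : erase u = []) :
    u = (replicate (cnt u) ()).map GSym.tm := by
  induction u with
  | nil => rfl
  | cons a u ih =>
    cases a with
    | nt A => simp [erase] at h
    | tm a => simpa [cnt, replicate_succ] using ih h

theorem exists_of_erase_eq {u : Str N Unit} {u₁ u₂ : List N} {A : N}
    (h : erase u = u₁ ++ A :: u₂) :
    ∃ v₁ v₂, u = v₁ ++ GSym.nt A :: v₂ ∧ erase v₁ = u₁ ∧ erase v₂ = u₂ := by
  induction u generalizing u₁ with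
  | nil => simp [erase] at h
  | cons a u ih =>
    cases a with
    | nt a =>
      cases u₁ with
      | nil =>
        simp only [erase, nil_append, cons.injEq] at h
        exact ⟨[], u, by simp [h.1], rfl, h.2⟩
      | cons b u₁ =>
        simp only [erase, cons_append, cons.injEq] at h
        obtain ⟨v₁, v₂, rfl, h₁, h₂⟩ := ih h.2
        exact ⟨GSym.nt a :: v₁, v₂, rfl, by simp [erase, h.1, h₁], h₂⟩
    | tm a =>
      obtain ⟨v₁, v₂, rfl, h₁, h₂⟩ := ih h
      exact ⟨GSym.tm a :: v₁, v₂, rfl, h₁, h₂⟩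

theorem EMatch.of_scMatch {ps : List (Comp N)} {u v : Str N Unit}
    (h : SCMatch (ps.map Comp.toPair) u v) :
    EMatch ps (erase u) (erase v) ∧ cnt v = cnt u + gain ps := by
  induction ps generalizing u v with
  | nil => obtain rfl : u = v := h; simp [EMatch, gain]
  | cons q ps ih =>
    obtain ⟨u₁, u', v', rfl, rfl, h⟩ := h
    obtain ⟨h₁, h₂⟩ := ih h
    refine ⟨⟨erase u₁, erase u', erase v', ?_, ?_, h₁⟩, ?_⟩
    · simp [erase_append, erase]
    · rw [erase_append, erase_append, erase_replacement]
    · rw [cnt_append, cnt_append, cnt_replacement, h₂]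
      simp only [cnt_append, cnt, gain, map_cons, sum_cons]
      omega

theorem EMatch.exists_scMatch {ps : List (Comp N)} {u : Str N Unit} {w : List N}
    (h : EMatch ps (erase u) w) : ∃ v, SCMatch (ps.map Comp.toPair) u v ∧ erase v = w := by
  induction ps generalizing u w with
  | nil => exact ⟨u, rfl, h⟩
  | cons q ps ih =>
    obtain ⟨u₁, u', v', hu, rfl, h⟩ := h
    obtain ⟨v₁, v₂, rfl, rfl, rfl⟩ := exists_of_erase_eq hu
    obtain ⟨v, hv, rfl⟩ := ih h
    refine ⟨_, ⟨v₁, v₂, v, rfl, rfl, hv⟩, ?_⟩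
    rw [erase_append, erase_append, erase_replacement]

theorem mem_language_iff {g : SCG N Unit} {R : List (List (Comp N))}
    (hg : g.prods = R.map (map Comp.toPair)) (w : List Unit) :
    w ∈ g.language ↔ ReflTransGen (EStep R) ([g.start], 0) ([], w.length) := by
  change ReflTransGen g.Step _ _ ↔ _
  constructor
  · intro h
    have := ReflTransGen.lift (p := EStep R) (fun u => (erase u, cnt u)) ?_ _ _ h
    · simpa [Function.onFun, erase, cnt, erase_map_tm, cnt_map_tm] using this
    · rintro u v ⟨p, hp, h⟩
      rw [hg, mem_map] at hp
      obtain ⟨q, hq, rfl⟩ := hp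
      exact ⟨q, hq, EMatch.of_scMatch h⟩
  · intro h
    have key : ∀ a : List N × ℕ, ReflTransGen (EStep R) ([g.start], 0) a →
        ∃ u, ReflTransGen g.Step [GSym.nt g.start] u ∧ erase u = a.1 ∧ cnt u = a.2 := by
      intro a ha
      induction ha with
      | refl => exact ⟨_, .refl, rfl, rfl⟩
      | tail _ hs ih =>
        obtain ⟨u, hu, h₁, h₂⟩ := ih
        obtain ⟨p, hp, hm, hc⟩ := hs
        rw [← h₁] at hm
        obtain ⟨v, hv, hw⟩ := hm.exists_scMatch
        refine ⟨v, hu.tail ⟨_, ?_, hv⟩, hw, ?_⟩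
        · rw [hg]; exact mem_map_of_mem hp
        · rw [(EMatch.of_scMatch hv).2, h₂, hc]
    obtain ⟨u, hu, h₁, h₂⟩ := key _ h
    have := eq_replicate_of_erase_eq_nil h₁
    rw [h₂] at this
    have hw : w = replicate w.length () := by simp [eq_replicate_iff]
    rw [← hw] at this
    exact this ▸ hu

theorem EMatch.mem {ps : List (Comp N)} {u v : List N} (h : EMatch ps u v) :
    ∀ q ∈ ps, q.1 ∈ u := by
  induction ps generalizing u v with
  | nil => simp
  | cons q ps ih =>
    obtain ⟨u₁, u', v', rfl, rfl, h⟩ := h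
    intro r hr
    rcases mem_cons.1 hr with rfl | hr
    · simp
    · simp [ih h r hr]

theorem EMatch.marker {m : N} {x : List N} {c : ℕ} {ps : List (Comp N)} {p s v : List N}
    (h : EMatch ((m, x, c) :: ps) (p ++ m :: s) v) (hp : m ∉ p) (hs : m ∉ s) :
    ∃ v', v = p ++ x ++ v' ∧ EMatch ps s v' := by
  obtain ⟨u₁, u', v', hu, rfl, h⟩ := h
  obtain ⟨rfl, -, rfl⟩ := (append_cons_inj_of_notMem hp hs).1 hu
  exact ⟨v', rfl, h⟩

theorem EMatch.letter_marker {b m : N} {x y : List N} {c d i : ℕ} {ps : List (Comp N)}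
    {s v : List N} (h : EMatch ((b, x, c) :: (m, y, d) :: ps) (replicate i b ++ m :: s) v)
    (hbm : m ≠ b) (hs : m ∉ s) :
    ∃ p q v', i = p + 1 + q ∧ v = replicate p b ++ x ++ replicate q b ++ y ++ v' ∧
      EMatch ps s v' := by
  obtain ⟨u₁, u', w, hu, rfl, u₂, u'', v', rfl, rfl, h⟩ := h
  have hb : m ∉ replicate i b := fun hm => hbm (eq_of_mem_replicate hm)
  rw [← cons_append, ← append_assoc] at hu
  obtain ⟨hr, -, rfl⟩ := (append_cons_inj_of_notMem hb hs).1 hu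
  obtain ⟨hl, h₁, h₂⟩ := append_eq_replicate_iff.1 hr.symm
  simp only [length_cons] at hl h₂
  simp only [replicate_succ, cons.injEq] at h₂
  refine ⟨u₁.length, u₂.length, v', by omega, ?_, h⟩
  rw [← h₁, ← h₂.2]
  simp

theorem EMatch.intro (p : List N) {m : N} {x : List N} {c : ℕ} {ps : List (Comp N)}
    {s v : List N} (h : EMatch ps s v) :
    EMatch ((m, x, c) :: ps) (p ++ m :: s) (p ++ x ++ v) :=
  ⟨p, s, v, rfl, rfl, h⟩

end Abstraction

open NT

section Grammar

variable (k l m d : ℕ)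

/-- The productions of the grammar for the parameters `k + 1` and `l + 1`, where
`m + 3 = (k + 1) ^ 2` and `d + 4 = (l + 1) ^ 3`. The production for `(Z, H)` is the last one
that can take part in a terminating derivation; the three after it are unreachable. -/
def rules : List (List (Comp NT)) :=
  [[(S, [], l + 1)],
   [(S, [], (l + 1) ^ (k + 1))],
   [(S, C :: replicate m B ++ [K, E], 0)],
   [(C, [], k), (B, [C], 0), (K, K :: replicate (k + 1) B, 0)],
   [(C, [], 4 * k - 1), (B, [], 1), (K, [C], 0), (E, replicate (4 * k + 1) B ++ [K, E], 0)],
   [(E, [D, A, H, F], 0)],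
   [(D, [], 4 * l), (A, [D], 0), (H, H :: replicate (l + 1) A, 0)],
   [(C, [], 1), (B, [C], 0), (K, [K], 0), (D, [], 4 * l - 3), (A, [], 1), (H, [D], 0),
    (F, replicate (l + 1) A ++ [H, F], 0)],
   [(C, [], 1), (K, [], 1), (D, [Z], 0), (F, [], 1)],
   [(Z, [], d), (A, [Z], 0), (H, [H], 0)],
   [(Z, [], 1), (H, [], m)],
   [(U, [V], 0)],
   [(V, [U], 0)],
   [(U, [], 1), (V, [], 1)]]

/-- Sentential form while the tokens `B` are multiplied; `s` tokens have been lost. -/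
def tokenForm (s i j : ℕ) : List NT :=
  replicate s B ++ C :: (replicate i B ++ K :: (replicate j B ++ [E]))

/-- Sentential form while each token triggers one multiplication of the symbols `A`. -/
def powerForm (s i b t x y : ℕ) : List NT :=
  replicate s B ++ C :: (replicate i B ++ K :: ((replicate b B ++ replicate t A) ++
    D :: (replicate x A ++ H :: (replicate y A ++ [F]))))

/-- Sentential form while the symbols `A` are turned into terminals. -/
def outputForm (s t x y : ℕ) : List NT :=
  (replicate s B ++ replicate t A) ++ Z :: (replicate x A ++ H :: replicate y A)

/-- The reachable configurations. The arithmetic facts hold only if no symbol has been lost. -/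
inductive Inv : List NT × ℕ → Prop
  | start : Inv ([S], 0)
  | token (s i j c : ℕ)
      (h : s = 0 → ∃ n t M, M + 3 = (k + 1) ^ n ∧ i + t = M ∧ j = (k + 1) * t ∧
        c + m = M + k * t) :
      Inv (tokenForm s i j, c)
  | power (s i b t x y c : ℕ)
      (h : s = 0 → b = 0 → t = 0 → ∃ n e r, i + e + 3 = (k + 1) ^ n ∧
        x + r = (l + 1) ^ e ∧ y = (l + 1) * r ∧
        c + m + 4 = i + 4 * (l + 1) ^ e + 4 * l * r) :
      Inv (powerForm s i b t x y, c)
  | output (s t x y c : ℕ)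
      (h : s = 0 → t = 0 → y = 0 → ∃ n, c + d * x + m + 1 = (l + 1) ^ (k + 1) ^ n) :
      Inv (outputForm s t x y, c)
  | done (s t c : ℕ) (h : s = 0 → t = 0 → ∃ n, c = (l + 1) ^ (k + 1) ^ n) :
      Inv (replicate s B ++ replicate t A, c)

variable {k l m d}

theorem Inv.step_start (hm : m + 3 = (k + 1) ^ 2) {b : List NT × ℕ}
    (h : EStep (rules k l m d) ([S], 0) b) : Inv k l m d b := by
  obtain ⟨v, c⟩ := b
  obtain ⟨p, hp, he, hc⟩ := h
  simp only [rules, mem_cons, not_mem_nil, or_false] at hp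
  rcases hp with rfl | rfl | rfl | rfl | rfl | rfl | rfl | rfl | rfl | rfl | rfl | rfl | rfl | rfl
  all_goals try (have hmem := he.mem; simp at hmem; done)
  all_goals
    replace he := EMatch.marker (p := []) he (by simp) (by simp)
    obtain ⟨v', rfl, he⟩ := he
    cases he
    simp only [gain, map_cons, map_nil, sum_cons, sum_nil] at hc
  · exact .done 0 0 c fun _ _ => ⟨0, by simp [hc]⟩
  · exact .done 0 0 c fun _ _ => ⟨1, by simp [hc]⟩
  · have := Inv.token (k := k) (l := l) (m := m) (d := d) 0 m 0 c fun _ =>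
      ⟨2, 0, m, hm, rfl, rfl, by simp [hc]⟩
    simpa [tokenForm] using this

theorem Inv.step_token (hk : 1 ≤ k) {s i j c : ℕ}
    (h : s = 0 → ∃ n t M, M + 3 = (k + 1) ^ n ∧ i + t = M ∧ j = (k + 1) * t ∧
        c + m = M + k * t) {b : List NT × ℕ}
    (hb : EStep (rules k l m d) (tokenForm s i j, c) b) : Inv k l m d b := by
  obtain ⟨v, c'⟩ := b
  obtain ⟨p, hp, he, hc⟩ := hb
  simp only [rules, mem_cons, not_mem_nil, or_false] at hp
  rcases hp with rfl | rfl | rfl | rfl | rfl | rfl | rfl | rfl | rfl | rfl | rfl | rfl | rfl | rfl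
  all_goals try (have hmem := he.mem; simp [tokenForm] at hmem; done)
  all_goals simp only [gain, map_cons, map_nil, sum_cons, sum_nil] at hc
  · replace he := EMatch.marker he (by simp) (by simp)
    obtain ⟨v', rfl, he⟩ := he
    replace he := he.letter_marker (by simp) (by simp)
    obtain ⟨p, q, w, rfl, rfl, he⟩ := he
    cases he
    have := Inv.token (k := k) (l := l) (m := m) (d := d) (s + p) q (k + 1 + j) c' fun hs => by
      replace h := h (by omega)
      obtain ⟨n, t, M, h₁, h₂, h₃, h₄⟩ := h
      exact ⟨n, t + 1, M, h₁, by omega, by rw [h₃]; ring, by rw [mul_add]; omega⟩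
    simpa [tokenForm, replicate_add, -replicate_append_replicate] using this
  · replace he := EMatch.marker he (by simp) (by simp)
    obtain ⟨v', rfl, he⟩ := he
    replace he := he.letter_marker (by simp) (by simp)
    obtain ⟨p, q, w, rfl, rfl, he⟩ := he
    replace he := he.marker (by simp) (by simp)
    obtain ⟨w', rfl, he⟩ := he
    cases he
    have := Inv.token (k := k) (l := l) (m := m) (d := d) (s + (p + q)) (j + (4 * k + 1)) 0 c'
      fun hs => by
      replace h := h (by omega)
      obtain ⟨n, t, M, h₁, h₂, h₃, h₄⟩ := h
      obtain rfl : p = 0 := by omega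
      obtain rfl : q = 0 := by omega
      subst h₂ h₃
      refine ⟨n + 1, 0, _, ?_, rfl, rfl, ?_⟩
      · rw [pow_succ, ← h₁]; ring
      · have : (k + 1) * t = k * t + t := by ring
        omega
    simpa [tokenForm, replicate_add, -replicate_append_replicate] using this
  · replace he : EMatch [(E, [D, A, H, F], 0)]
      ((replicate s B ++ C :: (replicate i B ++ K :: replicate j B)) ++ E :: []) v := by
      simpa [tokenForm] using he
    replace he := he.marker (by simp) (by simp)
    obtain ⟨v', rfl, he⟩ := he
    cases he
    have := Inv.power (k := k) (l := l) (m := m) (d := d) s i j 0 1 0 c' fun hs hj _ => by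
      replace h := h hs
      obtain ⟨n, t, M, h₁, h₂, h₃, h₄⟩ := h
      obtain rfl : t = 0 := by simpa [hj] using h₃
      exact ⟨n, 0, 0, by omega, by simp, rfl, by simp at *; omega⟩
    simpa [powerForm] using this

theorem Inv.step_power (hl : 1 ≤ l) (hd : d + 4 = (l + 1) ^ 3) {s i b t x y c : ℕ}
    (h : s = 0 → b = 0 → t = 0 → ∃ n e r, i + e + 3 = (k + 1) ^ n ∧
        x + r = (l + 1) ^ e ∧ y = (l + 1) * r ∧
        c + m + 4 = i + 4 * (l + 1) ^ e + 4 * l * r) {a : List NT × ℕ}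
    (ha : EStep (rules k l m d) (powerForm s i b t x y, c) a) : Inv k l m d a := by
  obtain ⟨v, c'⟩ := a
  obtain ⟨p, hp, he, hc⟩ := ha
  simp only [rules, mem_cons, not_mem_nil, or_false] at hp
  rcases hp with rfl | rfl | rfl | rfl | rfl | rfl | rfl | rfl | rfl | rfl | rfl | rfl | rfl | rfl
  all_goals try (have hmem := he.mem; simp [powerForm] at hmem; done)
  all_goals simp only [gain, map_cons, map_nil, sum_cons, sum_nil] at hc
  · replace he := EMatch.marker he (by simp) (by simp)
    obtain ⟨v', rfl, he⟩ := he
    replace he := he.letter_marker (by simp) (by simp)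
    obtain ⟨p, q, w, rfl, rfl, he⟩ := he
    cases he
    have := Inv.power (k := k) (l := l) (m := m) (d := d) (s + p) q (k + 1 + b) t x y c'
      fun _ hb => by omega
    simpa [powerForm, replicate_add, -replicate_append_replicate] using this
  · replace he : EMatch [(D, [], 4 * l), (A, [D], 0), (H, H :: replicate (l + 1) A, 0)]
      ((replicate s B ++ C :: (replicate i B ++ K :: (replicate b B ++ replicate t A))) ++
        D :: (replicate x A ++ H :: (replicate y A ++ [F]))) v := by
      simpa [powerForm] using he
    replace he := he.marker (by simp) (by simp)
    obtain ⟨v', rfl, he⟩ := he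
    replace he := he.letter_marker (by simp) (by simp)
    obtain ⟨p, q, w, rfl, rfl, he⟩ := he
    cases he
    have := Inv.power (k := k) (l := l) (m := m) (d := d) s i b (t + p) q (l + 1 + y) c'
      fun hs hb ht => by
      replace h := h hs hb (by omega)
      obtain ⟨n, e, r, h₁, h₂, h₃, h₄⟩ := h
      exact ⟨n, e, r + 1, h₁, by omega, by rw [h₃]; ring, by rw [mul_add]; omega⟩
    simpa [powerForm, replicate_add, -replicate_append_replicate] using this
  · replace he := EMatch.marker he (by simp) (by simp)
    obtain ⟨v', rfl, he⟩ := he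
    replace he := he.letter_marker (by simp) (by simp)
    obtain ⟨p, q, w, rfl, rfl, he⟩ := he
    replace he := he.marker (by simp) (by simp)
    obtain ⟨w, rfl, he⟩ := he
    replace he := he.letter_marker (by simp) (by simp)
    obtain ⟨p', q', w, rfl, rfl, he⟩ := he
    replace he := he.marker (by simp) (by simp)
    obtain ⟨w, rfl, he⟩ := he
    cases he
    have := Inv.power (k := k) (l := l) (m := m) (d := d) (s + p) q b (t + (p' + q'))
      (y + (l + 1)) 0 c' fun hs hb ht => by
      replace h := h (by omega) hb (by omega)
      obtain ⟨n, e, r, h₁, h₂, h₃, h₄⟩ := h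
      obtain rfl : p' = 0 := by omega
      obtain rfl : q' = 0 := by omega
      obtain rfl : p = 0 := by omega
      refine ⟨n, e + 1, 0, by omega, ?_, rfl, ?_⟩
      · rw [pow_succ, ← h₂, h₃]; ring
      · rw [pow_succ, ← h₂]
        rw [← h₂] at h₄
        have : (0 + 1 + 0 + r) * (l + 1) = l * r + r + l + 1 := by ring
        rw [this]
        rw [mul_assoc] at h₄
        omega
    simpa [powerForm, replicate_add, -replicate_append_replicate] using this
  · replace he := EMatch.marker he (by simp) (by simp)
    obtain ⟨w, rfl, he⟩ := he
    replace he := he.marker (by simp) (by simp)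
    obtain ⟨w, rfl, he⟩ := he
    replace he := he.marker (by simp) (by simp)
    obtain ⟨w, rfl, he⟩ := he
    replace he : EMatch [(F, [], 1)] ((replicate x A ++ H :: replicate y A) ++ F :: []) w := by
      simpa using he
    replace he := he.marker (by simp) (by simp)
    obtain ⟨w, rfl, he⟩ := he
    cases he
    have := Inv.output (k := k) (l := l) (m := m) (d := d) (s + (i + b)) t x y c'
      fun hs ht hy => by
      replace h := h (by omega) (by omega) ht
      obtain ⟨n, e, r, h₁, h₂, h₃, h₄⟩ := h
      obtain rfl : r = 0 := by simpa [hy] using h₃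
      obtain rfl : i = 0 := by omega
      refine ⟨n, ?_⟩
      rw [← h₁, zero_add, pow_add, ← h₂, ← hd]
      rw [← h₂] at h₄
      have : (x + 0) * (d + 4) = d * x + 4 * x := by ring
      omega
    simpa [outputForm, replicate_add, -replicate_append_replicate] using this

theorem Inv.step_output {s t x y c : ℕ}
    (h : s = 0 → t = 0 → y = 0 → ∃ n, c + d * x + m + 1 = (l + 1) ^ (k + 1) ^ n)
    {a : List NT × ℕ}
    (ha : EStep (rules k l m d) (outputForm s t x y, c) a) : Inv k l m d a := by
  obtain ⟨v, c'⟩ := a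
  obtain ⟨p, hp, he, hc⟩ := ha
  simp only [rules, mem_cons, not_mem_nil, or_false] at hp
  rcases hp with rfl | rfl | rfl | rfl | rfl | rfl | rfl | rfl | rfl | rfl | rfl | rfl | rfl | rfl
  all_goals try (have hmem := he.mem; simp [outputForm] at hmem; done)
  all_goals simp only [gain, map_cons, map_nil, sum_cons, sum_nil] at hc
  · replace he := EMatch.marker he (by simp) (by simp)
    obtain ⟨v', rfl, he⟩ := he
    replace he := he.letter_marker (by simp) (by simp)
    obtain ⟨p, q, w, rfl, rfl, he⟩ := he
    cases he
    have := Inv.output (k := k) (l := l) (m := m) (d := d) s (t + p) q y c' fun hs ht hy => by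
      replace h := h hs (by omega) hy
      obtain ⟨n, h⟩ := h
      obtain rfl : p = 0 := by omega
      refine ⟨n, ?_⟩
      rw [← h, hc]
      ring
    simpa [outputForm, replicate_add, -replicate_append_replicate] using this
  · replace he := EMatch.marker he (by simp) (by simp)
    obtain ⟨w, rfl, he⟩ := he
    replace he := he.marker (by simp) (by simp)
    obtain ⟨w, rfl, he⟩ := he
    cases he
    have := Inv.done (k := k) (l := l) (m := m) (d := d) s (t + (x + y)) c' fun hs ht => by
      replace h := h hs (by omega) (by omega)
      obtain ⟨n, h⟩ := h
      obtain rfl : x = 0 := by omega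
      exact ⟨n, by omega⟩
    simpa [replicate_add, -replicate_append_replicate] using this

theorem Inv.step (hk : 1 ≤ k) (hl : 1 ≤ l) (hm : m + 3 = (k + 1) ^ 2)
    (hd : d + 4 = (l + 1) ^ 3) {a b : List NT × ℕ} (ha : Inv k l m d a)
    (h : EStep (rules k l m d) a b) : Inv k l m d b := by
  cases ha with
  | start => exact step_start hm h
  | token s i j c ha => exact step_token hk ha h
  | power s i b t x y c ha => exact step_power hl hd ha h
  | output s t x y c ha => exact step_output ha h
  | done s t c =>
    obtain ⟨p, hp, he, -⟩ := h
    simp only [rules, mem_cons, not_mem_nil, or_false] at hp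
    rcases hp with
      rfl | rfl | rfl | rfl | rfl | rfl | rfl | rfl | rfl | rfl | rfl | rfl | rfl | rfl
    all_goals exact absurd he.mem (by simp)

theorem Inv.exists_eq {c : ℕ} (h : Inv k l m d ([], c)) : ∃ n, c = (l + 1) ^ (k + 1) ^ n := by
  generalize ha : (([], c) : List NT × ℕ) = a at h
  cases h with
  | start => simp at ha
  | token => simp [tokenForm] at ha
  | power => simp [powerForm] at ha
  | output => simp [outputForm] at ha
  | done s t c' h =>
    simp only [Prod.mk.injEq, nil_eq, append_eq_nil_iff, replicate_eq_nil_iff] at ha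
    exact ha.2 ▸ h ha.1.1 ha.1.2

/-- Reachability of configurations. -/
local notation "Reach" => ReflTransGen (EStep (rules k l m d))

theorem reach_token_sweep (i j c r : ℕ) :
    Reach (tokenForm 0 (i + r) j, c) (tokenForm 0 i (j + (k + 1) * r), c + k * r) := by
  induction r generalizing j c with
  | zero => exact .refl
  | succ r ih =>
    refine .head (b := (tokenForm 0 (i + r) (k + 1 + j), c + k)) ?_ ?_
    · refine ⟨[(C, [], k), (B, [C], 0), (K, K :: replicate (k + 1) B, 0)], by simp [rules], ?_,
        by simp [gain]⟩
      have : EMatch [(C, [], k), (B, [C], 0), (K, K :: replicate (k + 1) B, 0)] _ _ :=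
        .intro [] (.intro [] (.intro (replicate (i + r) B)
          (s := replicate j B ++ [E]) rfl))
      simpa [tokenForm, ← add_assoc, replicate_succ, replicate_add,
        -replicate_append_replicate] using this
    · have := ih (k + 1 + j) (c + k)
      rwa [show k + 1 + j + (k + 1) * r = j + (k + 1) * (r + 1) by ring,
        show c + k + k * r = c + k * (r + 1) by ring] at this

theorem reach_token_round (hk : 1 ≤ k) (i c : ℕ) :
    Reach (tokenForm 0 (i + 1) 0, c)
      (tokenForm 0 ((k + 1) * i + (4 * k + 1)) 0, c + k * i + 4 * k) := by
  rw [add_comm i]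
  refine (reach_token_sweep 1 0 c i).tail
    ⟨[(C, [], 4 * k - 1), (B, [], 1), (K, [C], 0), (E, replicate (4 * k + 1) B ++ [K, E], 0)],
      by simp [rules], ?_, by simp [gain]; omega⟩
  have : EMatch [(C, [], 4 * k - 1), (B, [], 1), (K, [C], 0),
      (E, replicate (4 * k + 1) B ++ [K, E], 0)] _ _ :=
    .intro [] (.intro [] (.intro [] (.intro (replicate ((k + 1) * i) B) (s := []) rfl)))
  simpa [tokenForm, replicate_add, -replicate_append_replicate] using this

theorem reach_power_sweep (i x y c r : ℕ) :
    Reach (powerForm 0 i 0 0 (x + r) y, c)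
      (powerForm 0 i 0 0 x (y + (l + 1) * r), c + 4 * l * r) := by
  induction r generalizing y c with
  | zero => exact .refl
  | succ r ih =>
    refine .head (b := (powerForm 0 i 0 0 (x + r) (l + 1 + y), c + 4 * l)) ?_ ?_
    · refine ⟨[(D, [], 4 * l), (A, [D], 0), (H, H :: replicate (l + 1) A, 0)],
        by simp [rules], ?_, by simp [gain]⟩
      have : EMatch [(D, [], 4 * l), (A, [D], 0), (H, H :: replicate (l + 1) A, 0)] _ _ :=
        .intro (C :: (replicate i B ++ [K])) (.intro [] (.intro (replicate (x + r) A)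
          (s := replicate y A ++ [F]) rfl))
      simpa [powerForm, ← add_assoc, replicate_succ, replicate_add,
        -replicate_append_replicate] using this
    · have := ih (l + 1 + y) (c + 4 * l)
      rwa [show l + 1 + y + (l + 1) * r = y + (l + 1) * (r + 1) by ring,
        show c + 4 * l + 4 * l * r = c + 4 * l * (r + 1) by ring] at this

theorem reach_power_round (hl : 1 ≤ l) (i x c : ℕ) :
    Reach (powerForm 0 (i + 1) 0 0 (x + 1) 0, c)
      (powerForm 0 i 0 0 ((l + 1) * (x + 1)) 0, c + 4 * l * x + (4 * l - 1)) := by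
  rw [add_comm x]
  refine (reach_power_sweep (i + 1) 1 0 c x).tail
    ⟨[(C, [], 1), (B, [C], 0), (K, [K], 0), (D, [], 4 * l - 3), (A, [], 1), (H, [D], 0),
      (F, replicate (l + 1) A ++ [H, F], 0)], by simp [rules], ?_, by simp [gain]; omega⟩
  have : EMatch [(C, [], 1), (B, [C], 0), (K, [K], 0), (D, [], 4 * l - 3), (A, [], 1), (H, [D], 0),
      (F, replicate (l + 1) A ++ [H, F], 0)] _ _ :=
    .intro [] (.intro [] (.intro (replicate i B) (.intro [] (.intro [] (.intro []
      (.intro (replicate ((l + 1) * x) A) (s := []) rfl))))))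
  rw [mul_add, mul_one, add_comm (l + 1)]
  simpa [powerForm, replicate_succ, replicate_add, -replicate_append_replicate] using this

theorem reach_power_rounds (hl : 1 ≤ l) (e i c : ℕ) :
    ∃ c', c' + e + 4 = c + 4 * (l + 1) ^ e ∧
      Reach (powerForm 0 (i + e) 0 0 1 0, c) (powerForm 0 i 0 0 ((l + 1) ^ e) 0, c') := by
  induction e generalizing i with
  | zero => exact ⟨c, by simp, .refl⟩
  | succ e ih =>
    obtain ⟨c', h, hr⟩ := ih (i + 1)
    obtain ⟨x, hx⟩ : ∃ x, (l + 1) ^ e = x + 1 :=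
      Nat.exists_eq_add_one.2 (by positivity)
    rw [hx] at h hr
    refine ⟨c' + 4 * l * x + (4 * l - 1), ?_, ?_⟩
    · rw [pow_succ', hx]
      have : 4 * ((l + 1) * (x + 1)) = 4 * l * x + 4 * l + 4 * (x + 1) := by ring
      omega
    · rw [pow_succ', hx, add_comm e, ← add_assoc]
      exact hr.trans (reach_power_round hl i x c')

theorem reach_output (x c : ℕ) : Reach (outputForm 0 0 x 0, c) ([], c + d * x + m + 1) := by
  induction x generalizing c with
  | zero =>
    refine .single ⟨[(Z, [], 1), (H, [], m)], by simp [rules], ?_, by simp [gain]; omega⟩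
    have : EMatch [(Z, [], 1), (H, [], m)] _ _ := .intro [] (.intro [] (s := []) rfl)
    simpa [outputForm] using this
  | succ x ih =>
    refine .head (b := (outputForm 0 0 x 0, c + d)) ?_ ?_
    · refine ⟨[(Z, [], d), (A, [Z], 0), (H, [H], 0)], by simp [rules], ?_, by simp [gain]⟩
      have : EMatch [(Z, [], d), (A, [Z], 0), (H, [H], 0)] _ _ :=
        .intro [] (.intro [] (.intro (replicate x A) (s := []) rfl))
      simpa [outputForm, replicate_succ] using this
    · convert ih (c + d) using 2; ring

theorem reach_tokens (hk : 1 ≤ k) (hm : m + 3 = (k + 1) ^ 2) (n : ℕ) :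
    ∃ c M, M + 3 = (k + 1) ^ (n + 2) ∧ c + m = M ∧ Reach ([S], 0) (tokenForm 0 M 0, c) := by
  induction n with
  | zero =>
    refine ⟨0, m, hm, by simp, .single
      ⟨[(S, C :: replicate m B ++ [K, E], 0)], by simp [rules], ?_, by simp [gain]⟩⟩
    have : EMatch [(S, C :: replicate m B ++ [K, E], 0)] _ _ := .intro [] (s := []) rfl
    simpa [tokenForm] using this
  | succ n ih =>
    obtain ⟨c, M, h₁, h₂, h₃⟩ := ih
    have hm' : 1 ≤ m := by nlinarith
    obtain ⟨i, rfl⟩ : ∃ i, M = i + 1 := Nat.exists_eq_add_one.2 (by omega)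
    refine ⟨_, _, ?_, ?_, h₃.trans (reach_token_round hk i c)⟩
    · rw [show n + 1 + 2 = n + 2 + 1 by ring, pow_succ, ← h₁]
      ring
    · have : (k + 1) * i = k * i + i := by ring
      omega

theorem reach_nil (hk : 1 ≤ k) (hl : 1 ≤ l) (hm : m + 3 = (k + 1) ^ 2)
    (hd : d + 4 = (l + 1) ^ 3) (n : ℕ) : Reach ([S], 0) ([], (l + 1) ^ (k + 1) ^ n) := by
  match n with
  | 0 =>
    refine .single ⟨[(S, [], l + 1)], by simp [rules], ?_, by simp [gain]⟩
    exact .intro [] (s := []) rfl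
  | 1 =>
    refine .single ⟨[(S, [], (l + 1) ^ (k + 1))], by simp [rules], ?_, by simp [gain]⟩
    exact .intro [] (s := []) rfl
  | n + 2 =>
    obtain ⟨c, M, h₁, h₂, h₃⟩ := reach_tokens (l := l) (d := d) hk hm n
    obtain ⟨c', h₄, h₅⟩ := reach_power_rounds (k := k) (m := m) (d := d) hl M 0 c
    rw [zero_add] at h₅
    have h₆ : EStep (rules k l m d) (tokenForm 0 M 0, c) (powerForm 0 M 0 0 1 0, c) := by
      refine ⟨[(E, [D, A, H, F], 0)], by simp [rules], ?_, by simp [gain]⟩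
      have : EMatch [(E, [D, A, H, F], 0)] _ _ :=
        .intro (C :: (replicate M B ++ [K])) (s := []) rfl
      simpa [tokenForm, powerForm] using this
    have h₇ : EStep (rules k l m d) (powerForm 0 0 0 0 ((l + 1) ^ M) 0, c')
        (outputForm 0 0 ((l + 1) ^ M) 0, c' + 3) := by
      refine ⟨[(C, [], 1), (K, [], 1), (D, [Z], 0), (F, [], 1)], by simp [rules], ?_,
        by simp [gain]⟩
      have : EMatch [(C, [], 1), (K, [], 1), (D, [Z], 0), (F, [], 1)] _ _ :=
        .intro [] (.intro [] (.intro [] (.intro (replicate ((l + 1) ^ M) A ++ [H]) (s := []) rfl)))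
      simpa [powerForm, outputForm] using this
    convert (((h₃.tail h₆).trans h₅).tail h₇).trans (reach_output _ _) using 2
    rw [← h₁, pow_add, ← hd]
    have : (l + 1) ^ M * (d + 4) = d * (l + 1) ^ M + 4 * (l + 1) ^ M := by ring
    omega

/-- The grammar with productions `rules k l m d`. -/
def grammar (k l m d : ℕ) : SCG NT Unit where
  prods := (rules k l m d).map (map Comp.toPair)
  start := S
  nonempty_prods := by simp [rules]

theorem grammar_nonerasing (hk : 1 ≤ k) (hl : 1 ≤ l) (hm : 1 ≤ m) (hd : 1 ≤ d) :
    (grammar k l m d).Nonerasing := by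
  have key : ∀ p ∈ rules k l m d, ∀ q ∈ p, q.2.1 ≠ [] ∨ q.2.2 ≠ 0 := by
    simp only [rules, forall_mem_cons]
    simp
    omega
  intro p hp q hq
  obtain ⟨p', hp', rfl⟩ := mem_map.1 hp
  obtain ⟨q', hq', rfl⟩ := mem_map.1 hq
  have := key p' hp' q' hq'
  simp only [Comp.toPair, ne_eq, append_eq_nil_iff, map_eq_nil_iff, replicate_eq_nil_iff]
  tauto

theorem grammar_language (hk : 1 ≤ k) (hl : 1 ≤ l) (hm : m + 3 = (k + 1) ^ 2)
    (hd : d + 4 = (l + 1) ^ 3) :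
    (grammar k l m d).language = {w | ∃ n : ℕ, w = replicate ((l + 1) ^ (k + 1) ^ n) ()} := by
  ext w
  rw [mem_language_iff (R := rules k l m d) rfl]
  constructor
  · intro h
    have hinv : ∀ a, Reach ([S], 0) a → Inv k l m d a := fun a ha => by
      induction ha with
      | refl => exact .start
      | tail _ hs ih => exact ih.step hk hl hm hd hs
    obtain ⟨n, hn⟩ := (hinv _ h).exists_eq
    exact ⟨n, by simp [eq_replicate_iff, hn]⟩
  · rintro ⟨n, rfl⟩
    simpa [grammar] using reach_nil hk hl hm hd n

end Grammar

end PowerTower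

/-- For any k, l ≥ 2, the language {a^(l^(kⁿ)) : n ≥ 0} over the one-letter
alphabet is a nonerasing scattered context language, generated by a grammar
with exactly twelve nonterminals and fourteen productions. -/
theorem power_tower_nonerasing_scattered_context (k l : ℕ) (hk : 2 ≤ k) (hl : 2 ≤ l) :
    ∃ (N : Type) (_ : Fintype N) (g : SCG N Unit),
      Fintype.card N = 12 ∧
      g.prods.length = 14 ∧
      g.Nonerasing ∧
      g.language = {w | ∃ n : ℕ, w = List.replicate (l ^ k ^ n) ()} := by
  obtain ⟨k, rfl⟩ : ∃ i, k = i + 1 := Nat.exists_eq_add_one.2 (by omega)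
  obtain ⟨l, rfl⟩ : ∃ i, l = i + 1 := Nat.exists_eq_add_one.2 (by omega)
  have hk' : 2 ^ 2 ≤ (k + 1) ^ 2 := Nat.pow_le_pow_left hk 2
  have hl' : 2 ^ 3 ≤ (l + 1) ^ 3 := Nat.pow_le_pow_left hl 3
  obtain ⟨m, hm⟩ := Nat.exists_eq_add_of_le' (show 3 ≤ (k + 1) ^ 2 by omega)
  obtain ⟨d, hd⟩ := Nat.exists_eq_add_of_le' (show 4 ≤ (l + 1) ^ 3 by omega)
  exact ⟨NT, inferInstance, PowerTower.grammar k l m d, rfl, rfl,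
    PowerTower.grammar_nonerasing (by omega) (by omega) (by omega) (by omega),
    PowerTower.grammar_language (by omega) (by omega) hm.symm hd.symm⟩
end

section
/- Every recursively enumerable language is generated by a scattered context grammar with three nonterminals in which every production rewrites at most nine nonterminals simultaneously. -/
/-- A type-0 (unrestricted) grammar: productions α → β with α containing a nonterminal. -/
structure Grammar (N T : Type) where
  prods : List (Str N T × Str N T)
  start : N
  lhs_nt : ∀ p ∈ prods, ∃ A : N, GSym.nt A ∈ p.1

def Grammar.Step {N T : Type} (g : Grammar N T) (u v : Str N T) : Prop :=
  ∃ p ∈ g.prods, ∃ x y : Str N T, u = x ++ p.1 ++ y ∧ v = x ++ p.2 ++ y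

def Grammar.language {N T : Type} (g : Grammar N T) : Set (List T) :=
  {w | Relation.ReflTransGen g.Step [GSym.nt g.start] (w.map GSym.tm)}

/-- A language is recursively enumerable iff it is generated by some type-0 grammar. -/
def IsRE {T : Type} (L : Set (List T)) : Prop :=
  ∃ (N : Type) (_ : Fintype N) (g : Grammar N T), g.language = L

namespace ThreeNonterminal

/-! ### Queue encoding of type-0 derivations -/

/-- A tile: a word to emit, a word to read and a word to write. -/
abbrev Tile (T Γ : Type) := List T × List Γ × List Γ

def emitted {T Γ : Type} (l : List (Tile T Γ)) : List T := l.flatMap fun t => t.1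

def consumed {T Γ : Type} (l : List (Tile T Γ)) : List Γ := l.flatMap fun t => t.2.1

def produced {T Γ : Type} (l : List (Tile T Γ)) : List Γ := l.flatMap fun t => t.2.2

theorem emitted_append {T Γ : Type} (l l' : List (Tile T Γ)) :
    emitted (l ++ l') = emitted l ++ emitted l' := by
  simp [emitted]

theorem emitted_cons {T Γ : Type} (t : Tile T Γ) (l : List (Tile T Γ)) :
    emitted (t :: l) = t.1 ++ emitted l := by
  simp [emitted]

/-- Working through the tiles `l`, starting with queue `q`, ends with queue `q'`. -/
def Runs {T Γ : Type} (q : List Γ) (l : List (Tile T Γ)) (q' : List Γ) : Prop :=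
  consumed l ++ q' = q ++ produced l

/-- Queue letters: grammar symbols and the separator `none`. -/
abbrev Letter (N T : Type) := Option (GSym N T)

/-- The symbols on which the grammar operates. -/
def symbols {N T : Type} (g : Grammar N T) : List (GSym N T) :=
  GSym.nt g.start :: g.prods.flatMap fun p => p.1 ++ p.2

def emitTile {N T : Type} : GSym N T → List (Tile T (Letter N T))
  | GSym.nt _ => []
  | GSym.tm a => [([a], [none, some (GSym.tm a)], [none])]

def tiles {N T : Type} (g : Grammar N T) : List (Tile T (Letter N T)) :=
  ([], [none], [none]) ::
    ((symbols g).map (fun x => ([], [some x], [some x])) ++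
      (g.prods.map (fun p => ([], p.1.map some, p.2.map some)) ++
        (symbols g).flatMap emitTile))

theorem mem_tiles {N T : Type} {g : Grammar N T} {t : Tile T (Letter N T)} :
    t ∈ tiles g ↔ t = ([], [none], [none]) ∨
      (∃ x ∈ symbols g, t = ([], [some x], [some x])) ∨
      (∃ p ∈ g.prods, t = ([], p.1.map some, p.2.map some)) ∨
      ∃ a, GSym.tm a ∈ symbols g ∧ t = ([a], [none, some (GSym.tm a)], [none]) := by
  have key : (∃ x ∈ symbols g, t ∈ emitTile x) ↔
      ∃ a, GSym.tm a ∈ symbols g ∧ t = ([a], [none, some (GSym.tm a)], [none]) := by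
    constructor
    · rintro ⟨x, hx, ht⟩
      cases x with
      | nt A => simp [emitTile] at ht
      | tm a => exact ⟨a, hx, by simpa [emitTile] using ht⟩
    · rintro ⟨a, ha, rfl⟩
      exact ⟨_, ha, by simp [emitTile]⟩
  simp only [tiles, List.mem_cons, List.mem_append, List.mem_map, List.mem_flatMap, key]
  simp only [eq_comm]

theorem Runs.trans {T Γ : Type} {q q' q'' : List Γ} {l l' : List (Tile T Γ)}
    (h : Runs q l q') (h' : Runs q' l' q'') : Runs q (l ++ l') q'' := by
  simp only [Runs, consumed, produced, List.flatMap_append, List.append_assoc] at *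
  rw [h', ← List.append_assoc, h, List.append_assoc]

/-- Soundness of the tiles: a run that ends with the bare separator emits a derivable word. -/
theorem derives_of_runs {N T : Type} {g : Grammar N T} (l : List (Tile T (Letter N T)))
    (hl : ∀ t ∈ l, t ∈ tiles g) (e : List T) (y y' : Str N T)
    (hd : Relation.ReflTransGen g.Step [GSym.nt g.start] (e.map GSym.tm ++ (y' ++ y)))
    (h : Runs (y.map some ++ none :: y'.map some) l [none]) :
    e ++ emitted l ∈ g.language := by
  induction l generalizing e y y' with
  | nil =>
    cases y <;> cases y' <;> simp_all [Runs, consumed, produced, emitted, Grammar.language]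
  | cons t l ih =>
    have hl' : ∀ t ∈ l, t ∈ tiles g := fun t ht => hl t (List.mem_cons_of_mem _ ht)
    rcases mem_tiles.1 (hl t List.mem_cons_self) with rfl | ⟨x, -, rfl⟩ | ⟨p, hp, rfl⟩ |
      ⟨a, -, rfl⟩
    · cases y with
      | cons z y => simp [Runs, consumed, produced] at h
      | nil =>
        have := ih hl' e y' [] (by simpa using hd)
          (by simpa [Runs, consumed, produced] using h)
        simpa [emitted] using this
    · cases y with
      | nil => simp [Runs, consumed, produced] at h
      | cons z y =>
        have hz : x = z := by
          simp [Runs, consumed, produced] at h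
          exact h.1
        subst hz
        have := ih hl' e y (y' ++ [x]) (by simpa using hd)
          (by simpa [Runs, consumed, produced] using h)
        simpa [emitted] using this
    · have hsplit : ∃ z, y = p.1 ++ z := by
        have h' : p.1.map some ++ (consumed l ++ [none]) = y.map some ++
            (none :: (y'.map some ++ produced (([], p.1.map some, p.2.map some) :: l))) := by
          simpa [Runs, consumed, produced] using h
        rcases List.append_eq_append_iff.1 h' with ⟨c, h1, -⟩ | ⟨c, h1, h2⟩
        · obtain ⟨a, b, rfl, ha, -⟩ := List.map_eq_append_iff.1 h1
          exact ⟨b, by rw [(List.map_injective_iff.2 (Option.some_injective _)) ha]⟩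
        · obtain ⟨a, b, hab, ha, hb⟩ := List.map_eq_append_iff.1 h1
          cases b with
          | nil =>
            exact ⟨[], by
              rw [hab, (List.map_injective_iff.2 (Option.some_injective _)) ha]; simp⟩
          | cons b bs => subst hb; simp at h2
      obtain ⟨z, rfl⟩ := hsplit
      have := ih hl' e z (y' ++ p.2)
        (hd.tail ⟨p, hp, e.map GSym.tm ++ y', z, by simp, by simp⟩)
        (by simpa [Runs, consumed, produced] using h)
      simpa [emitted] using this
    · cases y with
      | cons z y => simp [Runs, consumed, produced] at h
      | nil =>
        cases y' with
        | nil => simp [Runs, consumed, produced] at h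
        | cons z y' =>
          have hz : GSym.tm a = z := by
            simp [Runs, consumed, produced] at h
            exact h.1
          subst hz
          have := ih hl' (e ++ [a]) y' [] (by simpa using hd)
            (by simpa [Runs, consumed, produced] using h)
          simpa [emitted] using this

theorem exists_runs_copy {N T : Type} {g : Grammar N T} (x : Str N T)
    (hx : ∀ a ∈ x, a ∈ symbols g) (q : List (Letter N T)) :
    ∃ l, (∀ t ∈ l, t ∈ tiles g) ∧ emitted l = [] ∧
      Runs (x.map some ++ q) l (q ++ x.map some) := by
  refine ⟨x.map fun a => ([], [some a], [some a]), ?_, ?_, ?_⟩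
  · intro t ht
    obtain ⟨a, ha, rfl⟩ := List.mem_map.1 ht
    exact mem_tiles.2 (Or.inr (Or.inl ⟨a, hx a ha, rfl⟩))
  · simp [emitted, List.flatMap_map]
  · have : ∀ x : Str N T, x.flatMap (fun a => [some a]) = x.map some := fun x => by
      induction x <;> simp_all
    simp [Runs, consumed, produced, List.flatMap_map, this]

theorem exists_runs_step {N T : Type} {g : Grammar N T} {u v : Str N T} (h : g.Step u v)
    (hu : ∀ a ∈ u, a ∈ symbols g) :
    ∃ l, (∀ t ∈ l, t ∈ tiles g) ∧ emitted l = [] ∧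
      Runs (none :: u.map some) l (none :: v.map some) := by
  obtain ⟨p, hp, x, z, rfl, rfl⟩ := h
  obtain ⟨l₁, hl₁, he₁, h₁⟩ := exists_runs_copy (g := g) x
    (fun a ha => hu a (by simp [ha])) (p.1.map some ++ z.map some ++ [none])
  obtain ⟨l₂, hl₂, he₂, h₂⟩ := exists_runs_copy (g := g) z
    (fun a ha => hu a (by simp [ha])) (none :: (x ++ p.2).map some)
  refine ⟨([], [none], [none]) :: (l₁ ++ ([], p.1.map some, p.2.map some) :: l₂), ?_, ?_, ?_⟩
  · intro t ht
    simp only [List.mem_cons, List.mem_append] at ht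
    rcases ht with rfl | ht | rfl | ht
    · exact mem_tiles.2 (Or.inl rfl)
    · exact hl₁ t ht
    · exact mem_tiles.2 (Or.inr (Or.inr (Or.inl ⟨p, hp, rfl⟩)))
    · exact hl₂ t ht
  · simp [emitted_append, emitted_cons, he₁, he₂]
  · have a₁ : Runs (none :: (x ++ p.1 ++ z).map some)
        [(([] : List T), [none], [none])] ((x ++ p.1 ++ z).map some ++ [none]) := by
      simp [Runs, consumed, produced]
    have a₂ : Runs (p.1.map some ++ z.map some ++ [none] ++ x.map some)
        [(([] : List T), p.1.map some, p.2.map some)]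
        (z.map some ++ none :: (x ++ p.2).map some) := by
      simp [Runs, consumed, produced]
    have h₁' : Runs ((x ++ p.1 ++ z).map some ++ [none]) l₁
        (p.1.map some ++ z.map some ++ [none] ++ x.map some) := by simpa using h₁
    have := a₁.trans (h₁'.trans (a₂.trans h₂))
    simpa using this

theorem exists_runs_emit {N T : Type} {g : Grammar N T} (w : List T)
    (hw : ∀ a ∈ w, GSym.tm a ∈ symbols g) :
    ∃ l, (∀ t ∈ l, t ∈ tiles g) ∧ emitted l = w ∧
      Runs (none :: (w.map GSym.tm).map some) l [none] := by
  induction w with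
  | nil => exact ⟨[], by simp, by simp [emitted], by simp [Runs, consumed, produced]⟩
  | cons a w ih =>
    obtain ⟨l₂, hl₂, he₂, h₂⟩ := ih fun b hb => hw b (List.mem_cons_of_mem _ hb)
    obtain ⟨l₁, hl₁, he₁, h₁⟩ := exists_runs_copy (g := g) (w.map GSym.tm)
      (fun b hb => by
        obtain ⟨c, hc, rfl⟩ := List.mem_map.1 hb
        exact hw c (List.mem_cons_of_mem _ hc)) [none]
    refine ⟨([a], [none, some (GSym.tm a)], [none]) :: (l₁ ++ l₂), ?_, ?_, ?_⟩
    · intro t ht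
      simp only [List.mem_cons, List.mem_append] at ht
      rcases ht with rfl | ht | ht
      · exact mem_tiles.2 (Or.inr (Or.inr (Or.inr ⟨a, hw a List.mem_cons_self, rfl⟩)))
      · exact hl₁ t ht
      · exact hl₂ t ht
    · simp [emitted_append, emitted_cons, he₁, he₂]
    · have a₁ : Runs (none :: ((a :: w).map GSym.tm).map some)
          [([a], [none, some (GSym.tm a)], [none])]
          ((w.map (GSym.tm (N := N))).map some ++ [none]) := by
        simp [Runs, consumed, produced]
      exact a₁.trans (h₁.trans h₂)

theorem exists_runs_derives {N T : Type} {g : Grammar N T} {u : Str N T}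
    (h : Relation.ReflTransGen g.Step [GSym.nt g.start] u) :
    (∀ a ∈ u, a ∈ symbols g) ∧ ∃ l, (∀ t ∈ l, t ∈ tiles g) ∧ emitted l = [] ∧
      Runs [none, some (GSym.nt g.start)] l (none :: u.map some) := by
  induction h with
  | refl =>
    exact ⟨by simp [symbols], [], by simp, by simp [emitted],
      by simp [Runs, consumed, produced]⟩
  | tail _ hs ih =>
    obtain ⟨hu, l, hl, he, hr⟩ := ih
    obtain ⟨l', hl', he', hr'⟩ := exists_runs_step hs hu
    refine ⟨?_, l ++ l', ?_, ?_, hr.trans hr'⟩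
    · obtain ⟨p, hp, x, z, rfl, rfl⟩ := hs
      intro a ha
      simp only [List.mem_append] at ha
      rcases ha with (ha | ha) | ha
      · exact hu a (by simp [ha])
      · refine List.mem_cons_of_mem _ (List.mem_flatMap.2 ⟨p, hp, by simp [ha]⟩)
      · exact hu a (by simp [ha])
    · intro t ht
      rcases List.mem_append.1 ht with ht | ht
      · exact hl t ht
      · exact hl' t ht
    · simp [emitted_append, he, he']

theorem mem_language_iff_runs {N T : Type} (g : Grammar N T) (w : List T) :
    w ∈ g.language ↔ ∃ l, (∀ t ∈ l, t ∈ tiles g) ∧ emitted l = w ∧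
      Runs [none, some (GSym.nt g.start)] l [none] := by
  constructor
  · intro h
    obtain ⟨hs, l, hl, he, hr⟩ := exists_runs_derives h
    obtain ⟨l', hl', he', hr'⟩ := exists_runs_emit (g := g) w fun a ha =>
      hs _ (List.mem_map_of_mem ha)
    refine ⟨l ++ l', ?_, ?_, hr.trans hr'⟩
    · intro t ht
      rcases List.mem_append.1 ht with ht | ht
      · exact hl t ht
      · exact hl' t ht
    · simp [emitted_append, he, he']
  · rintro ⟨l, hl, rfl, hr⟩
    have := derives_of_runs l hl [] [] [GSym.nt g.start] Relation.ReflTransGen.refl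
      (by simpa using hr)
    simpa using this

/-! ### Balanced binary codes -/

/-- The codeword `0ᵏ1ᵏ`. -/
def block (k : ℕ) : List Bool := List.replicate k false ++ List.replicate k true

theorem replicate_false_inj (k m : ℕ) (x y : List Bool)
    (h : List.replicate k false ++ true :: x = List.replicate m false ++ true :: y) :
    k = m ∧ x = y := by
  induction k generalizing m with
  | zero => cases m <;> simp_all [List.replicate_succ]
  | succ k ih =>
    cases m with
    | zero => simp [List.replicate_succ] at h
    | succ m =>
      have := ih m (by simpa [List.replicate_succ] using h)
      exact ⟨by rw [this.1], this.2⟩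

theorem block_inj (k m : ℕ) (x y : List Bool)
    (h : block (k + 1) ++ x = block (m + 1) ++ y) : k = m ∧ x = y := by
  have h' := replicate_false_inj (k + 1) (m + 1) (List.replicate k true ++ x)
    (List.replicate m true ++ y)
    (by simpa [block, List.replicate_succ (a := true)] using h)
  obtain rfl : k = m := by omega
  exact ⟨rfl, List.append_cancel_left h'.2⟩

/-- Encoding of words whose letters are numbered by their positions in a list. -/
def encode {Γ : Type} [DecidableEq Γ] (S : List Γ) (x : List Γ) : List Bool :=
  x.flatMap fun a => block (S.idxOf a + 1)

theorem encode_append {Γ : Type} [DecidableEq Γ] (S x y : List Γ) :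
    encode S (x ++ y) = encode S x ++ encode S y := by
  simp [encode]

theorem encode_injOn {Γ : Type} [DecidableEq Γ] (S x y : List Γ) (hx : ∀ a ∈ x, a ∈ S)
    (h : encode S x = encode S y) : x = y := by
  induction x generalizing y with
  | nil => cases y <;> simp_all [encode, block]
  | cons a x ih =>
    cases y with
    | nil => simp [encode, block] at h
    | cons b y =>
      have h' := block_inj (S.idxOf a) (S.idxOf b) (encode S x) (encode S y)
        (by simpa [encode] using h)
      rw [(List.idxOf_inj (hx a List.mem_cons_self)).1 h'.1,
        ih y (fun c hc => hx c (List.mem_cons_of_mem _ hc)) h'.2]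

/-- The number of `0`s minus the number of `1`s. -/
def imbalance (x : List Bool) : ℤ := (x.count false : ℤ) - x.count true

theorem imbalance_append (x y : List Bool) :
    imbalance (x ++ y) = imbalance x + imbalance y := by
  simp only [imbalance, List.count_append]
  push_cast
  ring

theorem imbalance_encode {Γ : Type} [DecidableEq Γ] (S x : List Γ) :
    imbalance (encode S x) = 0 := by
  induction x with
  | nil => simp [encode, imbalance]
  | cons a x ih =>
    have : encode S (a :: x) = block (S.idxOf a + 1) ++ encode S x := by simp [encode]
    rw [this, imbalance_append, ih]
    simp [block, imbalance, List.count_replicate]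

/-- Reversed complement. -/
def mirror (x : List Bool) : List Bool := (x.map (!·)).reverse

theorem mirror_mirror (x : List Bool) : mirror (mirror x) = x := by
  simp [mirror, Function.comp_def]

theorem mirror_append (x y : List Bool) : mirror (x ++ y) = mirror y ++ mirror x := by
  simp [mirror]

theorem imbalance_mirror (x : List Bool) : imbalance (mirror x) = -imbalance x := by
  induction x with
  | nil => simp [mirror, imbalance]
  | cons b x ih =>
    have : mirror (b :: x) = mirror x ++ [!b] := by simp [mirror]
    rw [this, imbalance_append, ih, ← List.singleton_append, imbalance_append]
    cases b <;> simp [imbalance] <;> ring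

/-! ### The comparison process -/

/-- Pairs of bit words obtained by appending tiles and cancelling equal first bits. -/
inductive Reach {T : Type} (ts : List (Tile T Bool)) (y₀ : List Bool) :
    List T → List Bool → List Bool → Prop
  | init : Reach ts y₀ [] [] y₀
  | tile {w x y} (t) (ht : t ∈ ts) (h : Reach ts y₀ w x y) :
      Reach ts y₀ (w ++ t.1) (x ++ t.2.1) (y ++ t.2.2)
  | cancel {w x y} (b) (h : Reach ts y₀ w (b :: x) (b :: y)) : Reach ts y₀ w x y

theorem Reach.exists_tiles {T : Type} {ts : List (Tile T Bool)} {y₀ : List Bool} {w x y}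
    (h : Reach ts y₀ w x y) : ∃ l c, (∀ t ∈ l, t ∈ ts) ∧ emitted l = w ∧
      consumed l = c ++ x ∧ y₀ ++ produced l = c ++ y := by
  induction h with
  | init => exact ⟨[], [], by simp [emitted, consumed, produced]⟩
  | tile t ht _ ih =>
    obtain ⟨l, c, hl, he, hu, hv⟩ := ih
    refine ⟨l ++ [t], c, ?_, ?_, ?_, ?_⟩
    · intro s hs
      rcases List.mem_append.1 hs with hs | hs
      · exact hl s hs
      · rwa [List.mem_singleton.1 hs]
    · simp_all [emitted]
    · simp_all [consumed]
    · have : produced (l ++ [t]) = produced l ++ t.2.2 := by simp [produced]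
      rw [this, ← List.append_assoc, hv, List.append_assoc]
  | cancel b _ ih =>
    obtain ⟨l, c, hl, he, hu, hv⟩ := ih
    exact ⟨l, c ++ [b], hl, he, by simpa using hu, by simpa using hv⟩

theorem Reach.of_tiles {T : Type} {ts : List (Tile T Bool)} {y₀ : List Bool}
    (l : List (Tile T Bool)) (hl : ∀ t ∈ l, t ∈ ts) :
    Reach ts y₀ (emitted l) (consumed l) (y₀ ++ produced l) := by
  induction l using List.reverseRecOn with
  | nil => simpa [emitted, consumed, produced] using Reach.init
  | append_singleton l t ih =>
    have := Reach.tile t (hl t (by simp)) (ih fun s hs => hl s (by simp [hs]))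
    simpa [emitted, consumed, produced] using this

theorem Reach.cancel_append {T : Type} {ts : List (Tile T Bool)} {y₀ : List Bool} {w}
    (c x y : List Bool) (h : Reach ts y₀ w (c ++ x) (c ++ y)) : Reach ts y₀ w x y := by
  induction c with
  | nil => exact h
  | cons b c ih => exact ih (Reach.cancel b h)

theorem reach_iff_runs {T : Type} (ts : List (Tile T Bool)) (y₀ q : List Bool) (w : List T) :
    Reach ts y₀ w [] q ↔ ∃ l, (∀ t ∈ l, t ∈ ts) ∧ emitted l = w ∧ Runs y₀ l q := by
  constructor
  · intro h
    obtain ⟨l, c, hl, he, hu, hv⟩ := h.exists_tiles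
    exact ⟨l, hl, he, by rw [Runs, hv, hu, List.append_nil]⟩
  · rintro ⟨l, hl, rfl, hr⟩
    have := Reach.of_tiles (y₀ := y₀) l hl
    rw [← hr] at this
    exact Reach.cancel_append (consumed l) [] q (by simpa using this)

/-! ### The scattered context grammar -/

/-- The marker. -/
def mark {T : Type} : GSym (Fin 3) T := GSym.nt 2

def bitNt (b : Bool) : Fin 3 := if b then 1 else 0

def bits {T : Type} (x : List Bool) : Str (Fin 3) T := x.map fun b => GSym.nt (bitNt b)

def startProd {T : Type} (y₀ : List Bool) : List (Fin 3 × Str (Fin 3) T) :=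
  [(2, mark :: mark :: (bits (mirror y₀) ++ mark :: bits [false]))]

def tileProd {T : Type} (t : Tile T Bool) : List (Fin 3 × Str (Fin 3) T) :=
  [(2, t.1.map GSym.tm ++ [mark]), (2, bits t.2.1 ++ mark :: bits (mirror t.2.2)),
    (2, [mark])]

def cancelProd {T : Type} (b : Bool) : List (Fin 3 × Str (Fin 3) T) :=
  [(2, []), (bitNt b, [mark]), (2, [mark]), (bitNt (!b), [mark]), (2, [])]

def finalProd {T : Type} : List (Fin 3 × Str (Fin 3) T) :=
  [(2, []), (2, []), (bitNt false, []), (bitNt true, []), (2, []), (bitNt false, [])]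

def scg {T : Type} (ts : List (Tile T Bool)) (y₀ : List Bool) : SCG (Fin 3) T where
  prods := startProd y₀ :: finalProd :: cancelProd false :: cancelProd true ::
    ts.map tileProd
  start := 2
  nonempty_prods := by
    intro p hp
    simp only [List.mem_cons, List.mem_map] at hp
    rcases hp with rfl | rfl | rfl | rfl | ⟨t, -, rfl⟩ <;>
      simp [startProd, finalProd, cancelProd, tileProd]

theorem length_le_of_mem_prods {T : Type} {ts : List (Tile T Bool)} {y₀ : List Bool}
    {p} (hp : p ∈ (scg ts y₀).prods) : p.length ≤ 9 := by
  simp only [scg, List.mem_cons, List.mem_map] at hp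
  rcases hp with rfl | rfl | rfl | rfl | ⟨t, -, rfl⟩ <;>
    simp [startProd, finalProd, cancelProd, tileProd]

theorem step_cases {T : Type} {ts : List (Tile T Bool)} {y₀ : List Bool} {u v}
    (h : (scg ts y₀).Step u v) : SCMatch (startProd y₀) u v ∨ SCMatch finalProd u v ∨
      (∃ b, SCMatch (cancelProd b) u v) ∨ ∃ t ∈ ts, SCMatch (tileProd t) u v := by
  obtain ⟨p, hp, h⟩ := h
  simp only [scg, List.mem_cons, List.mem_map] at hp
  rcases hp with rfl | rfl | rfl | rfl | ⟨t, ht, rfl⟩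
  · exact Or.inl h
  · exact Or.inr (Or.inl h)
  · exact Or.inr (Or.inr (Or.inl ⟨_, h⟩))
  · exact Or.inr (Or.inr (Or.inl ⟨_, h⟩))
  · exact Or.inr (Or.inr (Or.inr ⟨t, ht, h⟩))

/-- The sentential forms of successful derivations. -/
def form {T : Type} (w : List T) (x y : List Bool) : Str (Fin 3) T :=
  w.map GSym.tm ++ mark :: (bits x ++ mark :: (bits (mirror y) ++ mark :: bits [false]))

theorem Reach.derives {T : Type} {ts : List (Tile T Bool)} {y₀ : List Bool} {w x y}
    (h : Reach ts y₀ w x y) :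
    Relation.ReflTransGen (scg ts y₀).Step [GSym.nt 2] (form w x y) := by
  induction h with
  | init =>
    refine Relation.ReflTransGen.single ⟨startProd y₀, by simp [scg], [], [], [], ?_⟩
    simp [form, bits, SCMatch]
  | @tile w x y t ht _ ih =>
    refine ih.tail ⟨tileProd t, by simp only [scg, List.mem_cons, List.mem_map]; tauto,
      w.map GSym.tm, _, _, rfl, ?_, bits x, _, _, rfl, rfl, bits (mirror y), _, _, rfl, rfl,
      rfl⟩
    simp [form, bits, mirror_append]
  | @cancel w x y b _ ih =>
    refine ih.tail ⟨cancelProd b, by cases b <;> simp [scg], w.map GSym.tm, _,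
      mark :: (bits x ++ mark :: (bits (mirror y) ++ mark :: bits [false])), rfl, ?_,
      [], bits x ++ mark :: (bits (mirror (b :: y)) ++ mark :: bits [false]),
      bits x ++ mark :: (bits (mirror y) ++ mark :: bits [false]), rfl, rfl,
      bits x, _, bits (mirror y) ++ mark :: bits [false], rfl, ?_,
      bits (mirror y), mark :: bits [false], bits [false], ?_, ?_,
      [], _, _, rfl, rfl, rfl⟩
    · simp [form]
    · simp
    · simp [bits, mirror]
    · simp

theorem mem_language_of_reach {T : Type} {ts : List (Tile T Bool)} {y₀ : List Bool} {w}
    (h : Reach ts y₀ w [] [false, true]) : w ∈ (scg ts y₀).language := by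
  refine h.derives.tail ⟨finalProd, by simp [scg], w.map GSym.tm, _, [], rfl, ?_,
    [], _, [], rfl, rfl, [], _, [], rfl, rfl, [], _, [], rfl, rfl, [], _, [], rfl, rfl,
    [], [], [], rfl, rfl, rfl⟩
  simp

/-! ### Weights and marker counts -/

def weight {T : Type} : GSym (Fin 3) T → ℤ
  | GSym.nt 0 => -3
  | GSym.nt 1 => 3
  | GSym.nt 2 => 1
  | GSym.tm _ => 0

/-- The number of markers minus three times the imbalance. -/
def totalWeight {T : Type} (s : Str (Fin 3) T) : ℤ := (s.map weight).sum

def isMark {T : Type} : GSym (Fin 3) T → Bool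
  | GSym.nt A => A = 2
  | GSym.tm _ => false

/-- The number of markers. -/
def markCount {T : Type} (s : Str (Fin 3) T) : ℕ := s.countP isMark

theorem totalWeight_append {T : Type} (s t : Str (Fin 3) T) :
    totalWeight (s ++ t) = totalWeight s + totalWeight t := by
  simp [totalWeight]

theorem totalWeight_cons {T : Type} (a : GSym (Fin 3) T) (t : Str (Fin 3) T) :
    totalWeight (a :: t) = weight a + totalWeight t := by
  simp [totalWeight]

theorem totalWeight_nil {T : Type} : totalWeight ([] : Str (Fin 3) T) = 0 := rfl

theorem totalWeight_map_tm {T : Type} (w : List T) :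
    totalWeight (w.map (GSym.tm (N := Fin 3))) = 0 := by
  induction w <;> simp_all [totalWeight, weight]

theorem totalWeight_bits {T : Type} (x : List Bool) :
    totalWeight (bits (T := T) x) = -3 * imbalance x := by
  induction x with
  | nil => simp [bits, totalWeight, imbalance]
  | cons b x ih =>
    have : bits (T := T) (b :: x) = GSym.nt (bitNt b) :: bits x := rfl
    rw [this, totalWeight_cons, ih, ← List.singleton_append, imbalance_append]
    cases b <;> simp [imbalance, bitNt, weight] <;> ring

theorem totalWeight_of_match {T : Type} (p : List (Fin 3 × Str (Fin 3) T))
    {u v : Str (Fin 3) T} (h : SCMatch p u v) :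
    totalWeight v =
      totalWeight u + (p.map fun q => totalWeight q.2 - weight (T := T) (GSym.nt q.1)).sum := by
  induction p generalizing u v with
  | nil => simp [SCMatch] at h; simp [h]
  | cons q p ih =>
    obtain ⟨u₁, u', v', rfl, rfl, h⟩ := h
    simp only [totalWeight_append, totalWeight_cons, ih h, List.map_cons, List.sum_cons]
    ring

theorem markCount_of_match {T : Type} (p : List (Fin 3 × Str (Fin 3) T))
    {u v : Str (Fin 3) T} (h : SCMatch p u v) :
    (p.map Prod.fst).count 2 ≤ markCount u := by
  induction p generalizing u v with
  | nil => simp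
  | cons q p ih =>
    obtain ⟨u₁, u', v', rfl, rfl, h⟩ := h
    have := ih h
    simp only [markCount, List.countP_append, List.countP_cons, List.map_cons,
      List.count_cons, isMark] at *
    by_cases h2 : q.1 = 2 <;> simp [h2] <;> omega

theorem markCount_append {T : Type} (s t : Str (Fin 3) T) :
    markCount (s ++ t) = markCount s + markCount t := by
  simp [markCount]

theorem markCount_mark {T : Type} (s : Str (Fin 3) T) :
    markCount (mark :: s) = markCount s + 1 := by
  simp [markCount, isMark, mark]

theorem markCount_bits {T : Type} (x : List Bool) : markCount (bits (T := T) x) = 0 := by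
  induction x with
  | nil => rfl
  | cons b x ih =>
    cases b <;> simp [markCount, bits, isMark, bitNt]

theorem markCount_map_tm {T : Type} (w : List T) :
    markCount (w.map (GSym.tm (N := Fin 3))) = 0 := by
  simp [markCount, List.countP_eq_zero, isMark]

/-- Splitting at the first marker is unique. -/
theorem split_mark {T : Type} {s r s' r' : Str (Fin 3) T}
    (h : s ++ mark :: r = s' ++ GSym.nt 2 :: r') (hs : markCount s = 0)
    (hr : markCount r ≤ markCount r') : s' = s ∧ r' = r := by
  have hs' : markCount s' = 0 := by
    have := congrArg markCount h
    change markCount (s ++ mark :: r) = markCount (s' ++ mark :: r') at this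
    simp only [markCount_append, markCount_mark] at this
    omega
  rcases List.append_eq_append_iff.1 h with ⟨c, h1, h2⟩ | ⟨c, h1, h2⟩
  · cases c with
    | nil => simp_all [mark]
    | cons a c =>
      obtain ⟨rfl, -⟩ := List.cons_eq_cons.1 h2
      rw [h1, markCount_append, markCount_mark] at hs'
      omega
  · cases c with
    | nil => simp_all [mark]
    | cons a c =>
      obtain ⟨rfl, -⟩ := List.cons_eq_cons.1 h2
      change s = s' ++ mark :: c at h1
      rw [h1, markCount_append, markCount_mark] at hs
      omega

/-- A bit followed by all markers lies in the block of bits before the first marker. -/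
theorem split_bits {T : Type} {x : List Bool} {b : Bool} {r s' r' : Str (Fin 3) T}
    (h : bits x ++ mark :: r = s' ++ GSym.nt (bitNt b) :: r')
    (hr : markCount r + 1 ≤ markCount r') :
    ∃ x₁ x₂, x = x₁ ++ b :: x₂ ∧ s' = bits x₁ ∧ r' = bits x₂ ++ mark :: r := by
  rcases List.append_eq_append_iff.1 h with ⟨c, h1, h2⟩ | ⟨c, h1, h2⟩
  · exfalso
    have := congrArg markCount h2
    have hb : markCount (GSym.nt (bitNt b) :: r') = markCount r' := by
      cases b <;> simp [markCount, isMark, bitNt]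
    rw [markCount_append, markCount_mark, hb] at this
    cases c with
    | nil => cases b <;> simp [mark, bitNt] at h2
    | cons a c =>
      obtain ⟨ha, -⟩ := List.cons.inj h2
      rw [← ha, markCount_mark] at this
      omega
  · cases c with
    | nil => cases b <;> simp [mark, bitNt] at h2
    | cons a c =>
      obtain ⟨rfl, rfl⟩ := List.cons_eq_cons.1 h2
      obtain ⟨x₁, x₂, rfl, rfl, hx⟩ := List.map_eq_append_iff.1 h1
      obtain ⟨b', x₃, rfl, hb, rfl⟩ := List.map_eq_cons_iff.1 hx
      have : b' = b := by
        cases b <;> cases b' <;> simp [bitNt] at hb <;> rfl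
      subst this
      exact ⟨x₁, x₃, rfl, rfl, rfl⟩

/-- Splitting a block of bits. -/
theorem split_bits_end {T : Type} {x : List Bool} {b : Bool} {s' r' : Str (Fin 3) T}
    (h : bits x = s' ++ GSym.nt (bitNt b) :: r') :
    ∃ x₁ x₂, x = x₁ ++ b :: x₂ ∧ s' = bits x₁ ∧ r' = bits x₂ := by
  obtain ⟨x₁, x₂, rfl, rfl, hx⟩ := List.map_eq_append_iff.1 h
  obtain ⟨b', x₃, rfl, hb, rfl⟩ := List.map_eq_cons_iff.1 hx
  have : b' = b := by
    cases b <;> cases b' <;> simp [bitNt] at hb <;> rfl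
  subst this
  exact ⟨x₁, x₃, rfl, rfl, rfl⟩

theorem bits_append {T : Type} (x y : List Bool) :
    bits (T := T) (x ++ y) = bits x ++ bits y := by
  simp [bits]

theorem append_bits_eq_map_tm {T : Type} {s : Str (Fin 3) T} {x : List Bool} {w : List T}
    (h : s ++ bits x = w.map GSym.tm) : x = [] ∧ s = w.map GSym.tm := by
  cases x with
  | nil => exact ⟨rfl, by simpa [bits] using h⟩
  | cons b x =>
    have : GSym.nt (bitNt b) ∈ w.map (GSym.tm (N := Fin 3)) := by
      rw [← h]; simp [bits]
    simp at this

/-! ### Soundness of the scattered context grammar -/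

/-- Three markers, with the bits lying outside of them lost forever. -/
def Active {T : Type} (ts : List (Tile T Bool)) (y₀ : List Bool) (s : Str (Fin 3) T) : Prop :=
  ∃ (a : Str (Fin 3) T) (x z d : List Bool), markCount a = 0 ∧
    s = a ++ mark :: (bits x ++ mark :: (bits z ++ mark :: bits (d ++ [false]))) ∧
    ∀ w, a = w.map GSym.tm → d = [] → Reach ts y₀ w x (mirror z)

def Finished {T : Type} (ts : List (Tile T Bool)) (y₀ : List Bool) (s : Str (Fin 3) T) : Prop :=
  markCount s = 0 ∧ ∀ w, s = w.map GSym.tm → Reach ts y₀ w [] [false, true]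

theorem Active.tile {T : Type} {ts : List (Tile T Bool)} {y₀ : List Bool} {s s'}
    (h : Active ts y₀ s) {t} (ht : t ∈ ts) (hm : SCMatch (tileProd t) s s') :
    Active ts y₀ s' := by
  obtain ⟨a, x, z, d, ha, rfl, hR⟩ := h
  obtain ⟨u₁, r₁, _, h₁, rfl, hm₁⟩ := hm
  have c₁ := markCount_of_match _ hm₁
  obtain ⟨u₂, r₂, _, h₂, rfl, hm₂⟩ := hm₁
  have c₂ := markCount_of_match _ hm₂
  obtain ⟨u₃, r₃, _, h₃, rfl, rfl⟩ := hm₂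
  obtain ⟨rfl, rfl⟩ := split_mark h₁ ha (by
    simp [markCount_append, markCount_mark, markCount_bits] at c₁ ⊢; exact c₁)
  obtain ⟨rfl, rfl⟩ := split_mark h₂ (markCount_bits _) (by
    simp [markCount_append, markCount_mark, markCount_bits] at c₂ ⊢; exact c₂)
  obtain ⟨rfl, rfl⟩ := split_mark h₃ (markCount_bits _) (by
    simp [markCount_bits])
  refine ⟨u₁ ++ t.1.map GSym.tm, x ++ t.2.1, mirror t.2.2 ++ z, d, ?_, ?_, ?_⟩
  · rw [markCount_append, ha, markCount_map_tm]
  · simp [bits_append]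
  · intro w hw hd
    obtain ⟨w₁, w₂, rfl, h1, h2⟩ := List.map_eq_append_iff.1 hw.symm
    have h2' : w₂ = t.1 :=
      (List.map_injective_iff.2 (fun _ _ h => GSym.tm.inj h)) h2
    subst h2'
    rw [mirror_append, mirror_mirror]
    exact Reach.tile t ht (hR _ h1.symm hd)

theorem Active.cancel {T : Type} {ts : List (Tile T Bool)} {y₀ : List Bool} {s s'}
    (h : Active ts y₀ s) {b} (hm : SCMatch (cancelProd b) s s') : Active ts y₀ s' := by
  obtain ⟨a, x, z, d, ha, rfl, hR⟩ := h
  obtain ⟨u₁, r₁, _, h₁, rfl, hm₁⟩ := hm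
  have c₁ := markCount_of_match _ hm₁
  obtain ⟨u₂, r₂, _, h₂, rfl, hm₂⟩ := hm₁
  have c₂ := markCount_of_match _ hm₂
  obtain ⟨u₃, r₃, _, h₃, rfl, hm₃⟩ := hm₂
  have c₃ := markCount_of_match _ hm₃
  obtain ⟨u₄, r₄, _, h₄, rfl, hm₄⟩ := hm₃
  have c₄ := markCount_of_match _ hm₄
  obtain ⟨u₅, r₅, _, h₅, rfl, rfl⟩ := hm₄
  have hb : ∀ b, bitNt b ≠ 2 := by decide
  simp [hb] at c₁ c₂ c₃ c₄
  obtain ⟨rfl, rfl⟩ := split_mark h₁ ha (by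
    simpa [markCount_append, markCount_mark, markCount_bits] using c₁)
  obtain ⟨x₁, x₂, rfl, rfl, rfl⟩ := split_bits h₂ (by
    simpa [markCount_append, markCount_mark, markCount_bits] using c₂)
  obtain ⟨rfl, rfl⟩ := split_mark h₃ (markCount_bits _) (by
    simpa [markCount_append, markCount_mark, markCount_bits] using c₃)
  obtain ⟨z₁, z₂, rfl, rfl, rfl⟩ := split_bits h₄ (by
    simpa [markCount_append, markCount_mark, markCount_bits] using c₄)
  obtain ⟨rfl, rfl⟩ := split_mark h₅ (markCount_bits _) (by
    simp [markCount_bits])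
  refine ⟨u₁ ++ bits x₁, x₂, z₁, z₂ ++ d, ?_, ?_, ?_⟩
  · rw [markCount_append, ha, markCount_bits]
  · simp [bits_append]
  · intro w hw hd
    obtain ⟨rfl, rfl⟩ := append_bits_eq_map_tm hw
    obtain ⟨rfl, rfl⟩ := List.append_eq_nil_iff.1 hd
    have := hR w rfl rfl
    rw [mirror_append] at this
    exact Reach.cancel b (by simpa [mirror] using this)

theorem Active.final {T : Type} {ts : List (Tile T Bool)} {y₀ : List Bool} {s s'}
    (h : Active ts y₀ s) (hm : SCMatch finalProd s s') : Finished ts y₀ s' := by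
  obtain ⟨a, x, z, d, ha, rfl, hR⟩ := h
  obtain ⟨u₁, r₁, _, h₁, rfl, hm₁⟩ := hm
  have c₁ := markCount_of_match _ hm₁
  obtain ⟨u₂, r₂, _, h₂, rfl, hm₂⟩ := hm₁
  have c₂ := markCount_of_match _ hm₂
  obtain ⟨u₃, r₃, _, h₃, rfl, hm₃⟩ := hm₂
  have c₃ := markCount_of_match _ hm₃
  obtain ⟨u₄, r₄, _, h₄, rfl, hm₄⟩ := hm₃
  have c₄ := markCount_of_match _ hm₄
  obtain ⟨u₅, r₅, _, h₅, rfl, hm₅⟩ := hm₄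
  obtain ⟨u₆, r₆, _, h₆, rfl, rfl⟩ := hm₅
  have hb : ∀ b, bitNt b ≠ 2 := by decide
  simp [hb] at c₁ c₂ c₃ c₄
  obtain ⟨rfl, rfl⟩ := split_mark h₁ ha (by
    simpa [markCount_append, markCount_mark, markCount_bits] using c₁)
  obtain ⟨rfl, rfl⟩ := split_mark h₂ (markCount_bits _) (by
    simpa [markCount_append, markCount_mark, markCount_bits] using c₂)
  obtain ⟨z₁, z₂, rfl, rfl, rfl⟩ := split_bits h₃ (by
    simpa [markCount_append, markCount_mark, markCount_bits] using c₃)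
  obtain ⟨z₃, z₄, rfl, rfl, rfl⟩ := split_bits h₄ (by
    simpa [markCount_append, markCount_mark, markCount_bits] using c₄)
  obtain ⟨rfl, rfl⟩ := split_mark h₅ (markCount_bits _) (by
    simp [markCount_bits])
  obtain ⟨d₁, d₂, hd, rfl, rfl⟩ := split_bits_end h₆
  have hs : u₁ ++ [] ++ (bits x ++ [] ++ (bits z₁ ++ [] ++ (bits z₃ ++ [] ++
      (bits z₄ ++ [] ++ (bits d₁ ++ [] ++ bits d₂))))) =
      u₁ ++ bits (T := T) (x ++ z₁ ++ z₃ ++ z₄ ++ d₁ ++ d₂) := by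
    simp [bits_append]
  rw [hs]
  refine ⟨by rw [markCount_append, ha, markCount_bits], fun w hw => ?_⟩
  obtain ⟨hnil, rfl⟩ := append_bits_eq_map_tm hw
  simp only [List.append_eq_nil_iff] at hnil
  obtain ⟨⟨⟨⟨⟨rfl, rfl⟩, rfl⟩, rfl⟩, rfl⟩, rfl⟩ := hnil
  have hd' : d = [] := by simpa using congrArg List.length hd
  simpa [mirror] using hR w rfl hd'

theorem totalWeight_step {T : Type} {ts : List (Tile T Bool)} {y₀ : List Bool} {s s'}
    (hts : ∀ t ∈ ts, imbalance t.2.1 = 0 ∧ imbalance t.2.2 = 0)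
    (h : (scg ts y₀).Step s s') (hn : ¬ SCMatch (startProd y₀) s s') :
    totalWeight s' = totalWeight s := by
  rcases step_cases h with h | h | ⟨b, h⟩ | ⟨t, ht, h⟩
  · exact absurd h hn
  · rw [totalWeight_of_match _ h]
    simp [finalProd, totalWeight_nil, weight, bitNt]
  · rw [totalWeight_of_match _ h]
    cases b <;>
      simp [cancelProd, totalWeight_nil, totalWeight_cons, weight, bitNt, mark]
  · rw [totalWeight_of_match _ h]
    simp [tileProd, totalWeight_nil, totalWeight_cons, totalWeight_append, totalWeight_map_tm,
      totalWeight_bits, imbalance_mirror, weight, mark, hts t ht]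

theorem totalWeight_start {T : Type} {y₀ : List Bool} {s s' : Str (Fin 3) T}
    (hy : imbalance y₀ = 0) (h : SCMatch (startProd y₀) s s') :
    totalWeight s' = totalWeight s - 1 := by
  rw [totalWeight_of_match _ h]
  simp [startProd, totalWeight_cons, totalWeight_append,
    totalWeight_bits, imbalance_mirror, weight, mark, hy]
  simp [imbalance]
  ring

theorem active_of_start {T : Type} {ts : List (Tile T Bool)} {y₀ : List Bool} {s}
    (h : (scg ts y₀).Step [GSym.nt 2] s) :
    SCMatch (startProd y₀) [GSym.nt 2] s ∧ Active ts y₀ s := by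
  have hc : markCount ([GSym.nt 2] : Str (Fin 3) T) = 1 := by simp [markCount, isMark]
  have hb : ∀ b, bitNt b ≠ 2 := by decide
  rcases step_cases h with h | h | ⟨b, h⟩ | ⟨t, ht, h⟩
  · refine ⟨h, ?_⟩
    obtain ⟨u₁, r₁, _, h₁, rfl, rfl⟩ := h
    obtain ⟨rfl, rfl⟩ := split_mark (s := []) (r := []) h₁ rfl (by simp [markCount])
    refine ⟨[], [], mirror y₀, [], rfl, by simp [bits], ?_⟩
    intro w hw _
    obtain rfl : w = [] := by simpa using hw
    rw [mirror_mirror]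
    exact Reach.init
  · have := markCount_of_match _ h
    simp [finalProd, hb, hc] at this
  · have := markCount_of_match _ h
    simp [cancelProd, hb, hc] at this
  · have := markCount_of_match _ h
    simp [tileProd, hc] at this

theorem invariant {T : Type} {ts : List (Tile T Bool)} {y₀ : List Bool}
    (hts : ∀ t ∈ ts, imbalance t.2.1 = 0 ∧ imbalance t.2.2 = 0) (hy : imbalance y₀ = 0)
    {s} (h : Relation.ReflTransGen (scg ts y₀).Step [GSym.nt 2] s) :
    s = [GSym.nt 2] ∨ totalWeight s < 0 ∨
      totalWeight s ≤ 0 ∧ (Active ts y₀ s ∨ Finished ts y₀ s) := by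
  induction h with
  | refl => exact Or.inl rfl
  | @tail s s' _ hs ih =>
    right
    have hle : totalWeight s' ≤ totalWeight s := by
      by_cases hn : SCMatch (startProd y₀) s s'
      · rw [totalWeight_start hy hn]; omega
      · exact (totalWeight_step hts hs hn).le
    rcases ih with rfl | ih | ⟨hw, ih⟩
    · obtain ⟨hm, ha⟩ := active_of_start hs
      refine Or.inr ⟨?_, Or.inl ha⟩
      rw [totalWeight_start hy hm]
      simp [totalWeight, weight]
    · exact Or.inl (hle.trans_lt ih)
    · rcases step_cases hs with h | h
      · left
        rw [totalWeight_start hy h]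
        omega
      · refine Or.inr ⟨hle.trans hw, ?_⟩
        rcases ih with ih | ih
        · rcases h with h | ⟨b, h⟩ | ⟨t, ht, h⟩
          · exact Or.inr (ih.final h)
          · exact Or.inl (ih.cancel h)
          · exact Or.inl (ih.tile ht h)
        · exfalso
          have hc := ih.1
          have hb : ∀ b, bitNt b ≠ 2 := by decide
          rcases h with h | ⟨b, h⟩ | ⟨t, ht, h⟩ <;>
            have := markCount_of_match _ h <;>
            simp [finalProd, cancelProd, tileProd, hb, hc] at this

theorem mem_language_iff_reach {T : Type} {ts : List (Tile T Bool)} {y₀ : List Bool}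
    (hts : ∀ t ∈ ts, imbalance t.2.1 = 0 ∧ imbalance t.2.2 = 0) (hy : imbalance y₀ = 0)
    (w : List T) : w ∈ (scg ts y₀).language ↔ Reach ts y₀ w [] [false, true] := by
  refine ⟨fun h => ?_, mem_language_of_reach⟩
  rcases invariant hts hy h with h | h | ⟨-, h | h⟩
  · cases w with
    | nil => simp at h
    | cons a w => simp at h
  · simp [totalWeight_map_tm] at h
  · obtain ⟨a, x, z, d, -, h, -⟩ := h
    have := congrArg markCount h
    rw [markCount_map_tm, markCount_append, markCount_mark] at this
    omega
  · exact h.2 w rfl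

/-! ### Encoding the queue tiles -/

def encodeTile {T Γ : Type} [DecidableEq Γ] (S : List Γ) (t : Tile T Γ) : Tile T Bool :=
  (t.1, encode S t.2.1, encode S t.2.2)

theorem emitted_encode {T Γ : Type} [DecidableEq Γ] (S : List Γ) (l : List (Tile T Γ)) :
    emitted (l.map (encodeTile S)) = emitted l := by
  simp [emitted, List.flatMap_map, encodeTile]

theorem runs_encode_iff {T Γ : Type} [DecidableEq Γ] (S : List Γ) (l : List (Tile T Γ))
    (q q' : List Γ) (hq' : ∀ a ∈ q', a ∈ S) (hl : ∀ t ∈ l, ∀ a ∈ t.2.1, a ∈ S) :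
    Runs (encode S q) (l.map (encodeTile S)) (encode S q') ↔ Runs q l q' := by
  have h₁ : consumed (l.map (encodeTile S)) = encode S (consumed l) := by
    simp [consumed, List.flatMap_map, encodeTile, encode, List.flatMap_assoc]
  have h₂ : produced (l.map (encodeTile S)) = encode S (produced l) := by
    simp [produced, List.flatMap_map, encodeTile, encode, List.flatMap_assoc]
  rw [Runs, Runs, h₁, h₂, ← encode_append, ← encode_append]
  refine ⟨encode_injOn S _ _ fun a ha => ?_, fun h => by rw [h]⟩
  rcases List.mem_append.1 ha with ha | ha
  · obtain ⟨t, ht, ha⟩ := List.mem_flatMap.1 ha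
    exact hl t ht a ha
  · exact hq' a ha

theorem reach_encode_iff {T Γ : Type} [DecidableEq Γ] (S : List Γ) (ts : List (Tile T Γ))
    (q q' : List Γ) (hq' : ∀ a ∈ q', a ∈ S) (hts : ∀ t ∈ ts, ∀ a ∈ t.2.1, a ∈ S)
    (w : List T) :
    Reach (ts.map (encodeTile S)) (encode S q) w [] (encode S q') ↔
      ∃ l, (∀ t ∈ l, t ∈ ts) ∧ emitted l = w ∧ Runs q l q' := by
  rw [reach_iff_runs]
  constructor
  · rintro ⟨k, hk, rfl, hr⟩
    obtain ⟨l, hl, rfl⟩ : ∃ l' : List (Tile T Γ), (∀ t ∈ l', t ∈ ts) ∧ l'.map (encodeTile S) = k := by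
      clear hr
      induction k with
      | nil => exact ⟨[], by simp, rfl⟩
      | cons t k ih =>
        obtain ⟨t', ht', rfl⟩ := List.mem_map.1 (hk t List.mem_cons_self)
        obtain ⟨l', hl', rfl⟩ := ih fun s hs => hk s (List.mem_cons_of_mem _ hs)
        exact ⟨t' :: l', List.forall_mem_cons.2 ⟨ht', hl'⟩, rfl⟩
    exact ⟨l, hl, (emitted_encode S l).symm,
      (runs_encode_iff S l q q' hq' fun t ht => hts t (hl t ht)).1 hr⟩
  · rintro ⟨l, hl, rfl, hr⟩
    refine ⟨l.map (encodeTile S), ?_, emitted_encode S l,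
      (runs_encode_iff S l q q' hq' fun t ht => hts t (hl t ht)).2 hr⟩
    intro t ht
    obtain ⟨t', ht', rfl⟩ := List.mem_map.1 ht
    exact List.mem_map_of_mem (hl t' ht')

end ThreeNonterminal

/-- Every recursively enumerable language is generated by a scattered context
grammar with three nonterminals in which every production rewrites at most
nine nonterminals simultaneously. -/
theorem re_iff_three_nonterminal_scg_nine {T : Type} (L : Set (List T)) (hL : IsRE L) :
    ∃ g : SCG (Fin 3) T, (∀ p ∈ g.prods, p.length ≤ 9) ∧ g.language = L := by
  classical
  obtain ⟨N, _, g, rfl⟩ := hL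
  let S : List (ThreeNonterminal.Letter N T) :=
    none :: (ThreeNonterminal.tiles g).flatMap fun t => t.2.1
  let ts := (ThreeNonterminal.tiles g).map (ThreeNonterminal.encodeTile S)
  let y₀ := ThreeNonterminal.encode S [none, some (GSym.nt g.start)]
  refine ⟨ThreeNonterminal.scg ts y₀, fun p hp => ThreeNonterminal.length_le_of_mem_prods hp, ?_⟩
  have hts : ∀ t ∈ ts, ThreeNonterminal.imbalance t.2.1 = 0 ∧
      ThreeNonterminal.imbalance t.2.2 = 0 := by
    intro t ht
    obtain ⟨t, -, rfl⟩ := List.mem_map.1 ht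
    exact ⟨ThreeNonterminal.imbalance_encode _ _, ThreeNonterminal.imbalance_encode _ _⟩
  have hnone : ThreeNonterminal.encode S [none] = [false, true] := by
    simp [S, ThreeNonterminal.encode, ThreeNonterminal.block]
  ext w
  rw [ThreeNonterminal.mem_language_iff_reach hts (ThreeNonterminal.imbalance_encode _ _),
    ← hnone, ThreeNonterminal.reach_encode_iff S _ _ _ (by simp [S])
      (fun t ht a ha => List.mem_cons_of_mem _ (List.mem_flatMap.2 ⟨t, ht, ha⟩)),
    ThreeNonterminal.mem_language_iff_runs]
end

section
/- In the three-nonterminal grammar G of the main theorem, every inner sentential form of a successful derivation (after the first step and before the last) has the form S·ū·S·v̄·S·w̄·A, where ū ∈ (BBA+λ){ABB,BAB}*, v̄ ∈ {BBA,BAB}*{AaBB : a∈T}*(ABB+λ), and w̄ ∈ T*. -/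
/-- Kleene star of a set of words. -/
def InStar {α : Type} (X : Set (List α)) (w : List α) : Prop :=
  ∃ ps : List (List α), (∀ p ∈ ps, p ∈ X) ∧ w = ps.flatten

/-- Nonterminals of a Geffert normal form grammar. -/
inductive N5 where | S' | A | B | C | D deriving DecidableEq

/-- The three nonterminals of the constructed grammar. -/
inductive N3 where | S | A | B deriving DecidableEq

def OnAC {T : Type} (u : Str N5 T) : Prop := ∀ s ∈ u, s = GSym.nt N5.A ∨ s = GSym.nt N5.C
def OnBD {T : Type} (v : Str N5 T) : Prop := ∀ s ∈ v, s = GSym.nt N5.B ∨ s = GSym.nt N5.D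

/-- A right-hand side for S' of one of the Geffert forms uS'a, uS'v, λ. -/
def GeffertForm {T : Type} (r : Str N5 T) : Prop :=
  (∃ u : Str N5 T, ∃ a : T, OnAC u ∧ r = u ++ [GSym.nt N5.S'] ++ [GSym.tm a]) ∨
  (∃ u v : Str N5 T, OnAC u ∧ OnBD v ∧ r = u ++ [GSym.nt N5.S'] ++ v) ∨
  r = []

section Construction

variable {T : Type}

def nS : GSym N3 T := GSym.nt N3.S
def nA : GSym N3 T := GSym.nt N3.A
def nB : GSym N3 T := GSym.nt N3.B

/-- The homomorphism h on symbols: h(A)=ABB, h(B)=BBA, h(C)=h(D)=BAB,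
h(a)=AaBB, with S' mapped to the middle nonterminal S. -/
def hsym : GSym N5 T → Str N3 T
  | GSym.nt N5.S' => [nS]
  | GSym.nt N5.A => [nA, nB, nB]
  | GSym.nt N5.B => [nB, nB, nA]
  | GSym.nt N5.C => [nB, nA, nB]
  | GSym.nt N5.D => [nB, nA, nB]
  | GSym.tm a => [nA, GSym.tm a, nB, nB]

def hstr (r : Str N5 T) : Str N3 T := r.flatMap hsym

/-- Production (1): (S) → (SBBASABBSA). -/
def p1 : List (N3 × Str N3 T) :=
  [(N3.S, [nS, nB, nB, nA, nS, nA, nB, nB, nS, nA])]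

/-- Productions (2),(3): (S,S,S) → (S, h(u)Sh(a), S) resp. (S, h(u)Sh(v), S). -/
def p23 (r : Str N5 T) : List (N3 × Str N3 T) :=
  [(N3.S, [nS]), (N3.S, hstr r), (N3.S, [nS])]

/-- Production (4): (S,A,B,B,S,B,B,A,S) → (λ,λ,λ,S,S,S,λ,λ,λ). -/
def p4 : List (N3 × Str N3 T) :=
  [(N3.S, []), (N3.A, []), (N3.B, []), (N3.B, [nS]), (N3.S, [nS]),
   (N3.B, [nS]), (N3.B, []), (N3.A, []), (N3.S, [])]

/-- Production (5): (S,B,A,B,S,B,A,B,S) → (λ,λ,λ,S,S,S,λ,λ,λ). -/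
def p5 : List (N3 × Str N3 T) :=
  [(N3.S, []), (N3.B, []), (N3.A, []), (N3.B, [nS]), (N3.S, [nS]),
   (N3.B, [nS]), (N3.A, []), (N3.B, []), (N3.S, [])]

/-- Production (6): (S,B,B,A,S,A,B,B,S) → (λ,λ,λ,SBBA,S,S,λ,λ,λ). -/
def p6 : List (N3 × Str N3 T) :=
  [(N3.S, []), (N3.B, []), (N3.B, []), (N3.A, [nS, nB, nB, nA]), (N3.S, [nS]),
   (N3.A, [nS]), (N3.B, []), (N3.B, []), (N3.S, [])]

/-- Production (7): (S,B,B,A,S,A,B,B,S) → (λ,λ,λ,S,S,S,λ,λ,λ). -/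
def p7 : List (N3 × Str N3 T) :=
  [(N3.S, []), (N3.B, []), (N3.B, []), (N3.A, [nS]), (N3.S, [nS]),
   (N3.A, [nS]), (N3.B, []), (N3.B, []), (N3.S, [])]

/-- Production (8): (S,S,S,A) → (λ,λ,λ,λ). -/
def p8 : List (N3 × Str N3 T) :=
  [(N3.S, []), (N3.S, []), (N3.S, []), (N3.A, [])]

/-- The three-nonterminal scattered context grammar constructed from the
Geffert rules P. -/
def mainG (P : List (Str N5 T)) : SCG N3 T where
  prods := p1 :: (((P.filter fun r => !r.isEmpty).map p23) ++ [p4, p5, p6, p7, p8])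
  start := N3.S
  nonempty_prods := by
    intro p hp
    rcases List.mem_cons.mp hp with h | h
    · subst h; simp [p1]
    · rcases List.mem_append.mp h with h | h
      · obtain ⟨r, -, rfl⟩ := List.mem_map.mp h; simp [p23]
      · fin_cases h <;> simp [p4, p5, p6, p7, p8]

end Construction

section Counting

variable {T : Type}

/-- Whether a symbol is the nonterminal `n`. -/
def isNt (n : N3) : GSym N3 T → Bool
  | .nt m => decide (m = n)
  | .tm _ => false

/-- The number of occurrences of the nonterminal `n`. -/
def cnt (n : N3) (x : Str N3 T) : ℕ := x.countP (isNt n)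

@[simp] lemma cnt_nil (n : N3) : cnt n ([] : Str N3 T) = 0 := rfl

@[simp] lemma cnt_append (n : N3) (x y : Str N3 T) : cnt n (x ++ y) = cnt n x + cnt n y :=
  List.countP_append

@[simp] lemma cnt_cons_nt (n m : N3) (x : Str N3 T) :
    cnt n (.nt m :: x) = cnt n x + if m = n then 1 else 0 := by
  simp [cnt, List.countP_cons, isNt]

@[simp] lemma cnt_cons_tm (n : N3) (a : T) (x : Str N3 T) : cnt n (.tm a :: x) = cnt n x := by
  simp [cnt, isNt]

@[simp] lemma cnt_map_tm (n : N3) (w : List T) : cnt n (w.map GSym.tm : Str N3 T) = 0 := by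
  induction w <;> simp_all

lemma exists_eq_map_tm {x : Str N3 T} (h : ∀ n, cnt n x = 0) : ∃ w : List T, x = w.map .tm := by
  induction x with
  | nil => exact ⟨[], rfl⟩
  | cons c x ih =>
    cases c with
    | nt m => simpa using h m
    | tm a =>
      obtain ⟨w, rfl⟩ := ih fun n => by simpa using h n
      exact ⟨a :: w, rfl⟩

lemma SCMatch.cnt_eq (n : N3) {ps : List (N3 × Str N3 T)} {u v : Str N3 T} (h : SCMatch ps u v) :
    cnt n v + ps.countP (fun p => decide (p.1 = n)) =
      cnt n u + (ps.map fun p => cnt n p.2).sum := by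
  induction ps generalizing u v with
  | nil => simp_all [SCMatch]
  | cons p ps ih =>
    obtain ⟨u₁, u', v', rfl, rfl, h⟩ := h
    have := ih h
    simp [List.countP_cons]
    omega

lemma SCMatch.cnt_le (n : N3) {ps : List (N3 × Str N3 T)} {u v : Str N3 T} (h : SCMatch ps u v) :
    ps.countP (fun p => decide (p.1 = n)) ≤ cnt n u := by
  induction ps generalizing u v with
  | nil => simp
  | cons p ps ih =>
    obtain ⟨u₁, u', v', rfl, rfl, h⟩ := h
    have := ih h
    simp [List.countP_cons]
    omega

lemma SCMatch.exists_suffix {n : N3} {x : Str N3 T} {ps : List (N3 × Str N3 T)} {u v : Str N3 T}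
    (h : SCMatch (ps ++ [(n, x)]) u v) : ∃ p q s, u = p ++ .nt n :: s ∧ v = q ++ s := by
  induction ps generalizing u v with
  | nil =>
    obtain ⟨u₁, u', v', rfl, rfl, rfl⟩ := h
    exact ⟨u₁, u₁ ++ x, u', rfl, rfl⟩
  | cons p ps ih =>
    obtain ⟨u₁, u', v', rfl, rfl, h⟩ := h
    obtain ⟨a, b, s, rfl, rfl⟩ := ih h
    exact ⟨u₁ ++ .nt p.1 :: a, u₁ ++ p.2 ++ b, s, by simp, by simp⟩

lemma append_nt_inj {n : N3} {a b s t : Str N3 T} (ha : cnt n a = 0) (hb : cnt n b = 0)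
    (h : a ++ .nt n :: s = b ++ .nt n :: t) : a = b ∧ s = t := by
  induction a generalizing b with
  | nil =>
    cases b with
    | nil => simpa using h
    | cons c b =>
      obtain ⟨rfl, -⟩ := List.cons.inj h
      simp at hb
  | cons c a ih =>
    cases b with
    | nil =>
      obtain ⟨rfl, -⟩ := List.cons.inj h
      simp at ha
    | cons c' b =>
      obtain ⟨rfl, h'⟩ := List.cons.inj h
      have hc : cnt n a = 0 := by cases c <;> simp at ha ⊢ <;> omega
      have hc' : cnt n b = 0 := by cases c <;> simp at hb ⊢ <;> omega
      obtain ⟨rfl, rfl⟩ := ih hc hc' h'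
      exact ⟨rfl, rfl⟩

lemma exists_prefix_of_append_eq {n : N3} {z t p s : Str N3 T} (ht : cnt n t = 0)
    (h : z ++ t = p ++ .nt n :: s) : ∃ m, s = m ++ t := by
  rcases List.append_eq_append_iff.1 h with ⟨m, rfl, rfl⟩ | ⟨m, rfl, hm⟩
  · simp at ht
  · cases m with
    | nil => simp at hm; subst hm; simp at ht
    | cons c m => exact ⟨m, (List.cons.inj hm).2⟩

lemma append_nt_map_tm_eq_concat_nt {m n : N3} {u l : Str N3 T} {t : List T}
    (h : u ++ .nt m :: t.map .tm = l ++ [.nt n]) : t = [] ∧ m = n ∧ u = l := by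
  induction t using List.reverseRecOn with
  | nil =>
    obtain ⟨h₁, h₂⟩ := List.append_inj' h rfl
    simp_all
  | append_singleton t a =>
    have h' : (u ++ .nt m :: t.map .tm) ++ [.tm a] = l ++ [.nt n] := by simpa using h
    simpa using (List.append_inj' h' rfl).2

lemma append_nt_map_tm_eq_concat_tm {m n : N3} {u l : Str N3 T} {t : List T} {a : T}
    (h : u ++ .nt m :: t.map .tm = l ++ [.nt n, .tm a]) : t = [a] ∧ m = n ∧ u = l := by
  induction t using List.reverseRecOn with
  | nil =>
    have h' : u ++ [.nt m] = (l ++ [.nt n]) ++ [.tm a] := by simpa using h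
    simpa using (List.append_inj' h' rfl).2
  | append_singleton t b =>
    have h' : (u ++ .nt m :: t.map .tm) ++ [.tm b] = (l ++ [.nt n]) ++ [.tm a] := by simpa using h
    obtain ⟨h₁, h₂⟩ := List.append_inj' h' rfl
    obtain ⟨rfl, rfl, rfl⟩ := append_nt_map_tm_eq_concat_nt h₁
    simp_all

end Counting

section Configurations

variable {T : Type}

/-- Code words for `h(A)` (`true`) and `h(C)` (`false`). -/
def leftBlock : Bool → Str N3 T
  | true => [.nt .A, .nt .B, .nt .B]
  | false => [.nt .B, .nt .A, .nt .B]

/-- Code words for `h(B)` (`true`), `h(D)` (`false`) and `h(a)` for a terminal `a`. -/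
def rightBlock : Bool ⊕ T → Str N3 T
  | .inl true => [.nt .B, .nt .B, .nt .A]
  | .inl false => [.nt .B, .nt .A, .nt .B]
  | .inr a => [.nt .A, .tm a, .nt .B, .nt .B]

/-- The data of a sentential form `S u S v S w A`: whether `u` starts with the marker `BBA`,
the code blocks of `u` and `v`, whether `v` ends with the marker `ABB`, and `w`. -/
structure Conf (T : Type) where
  markL : Bool
  left : List Bool
  right : List (Bool ⊕ T)
  markR : Bool
  out : List T

namespace Conf

def leftStr (d : Conf T) : Str N3 T :=
  (if d.markL then [.nt .B, .nt .B, .nt .A] else []) ++ d.left.flatMap leftBlock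

def rightStr (d : Conf T) : Str N3 T :=
  d.right.flatMap rightBlock ++ if d.markR then [.nt .A, .nt .B, .nt .B] else []

/-- The sentential form described by a configuration. -/
def form (d : Conf T) : Str N3 T :=
  .nt .S :: (d.leftStr ++ .nt .S :: (d.rightStr ++ .nt .S :: (d.out.map .tm ++ [.nt .A])))

/-- In a live configuration no terminal block precedes a nonterminal block, and once the left
marker is gone only nonterminal blocks remain on the right. -/
def Live (d : Conf T) : Prop :=
  d.right.Pairwise (fun b c => b.isRight → c.isRight) ∧
    (d.markL = false → (∀ b ∈ d.right, b.isLeft) ∧ d.markR = false)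

lemma cnt_flatMap_leftBlock (l : List Bool) :
    cnt .S (l.flatMap leftBlock : Str N3 T) = 0 ∧
    cnt .B (l.flatMap leftBlock : Str N3 T) = 2 * cnt .A (l.flatMap leftBlock : Str N3 T) := by
  induction l with
  | nil => simp
  | cons b l ih => cases b <;> simp [leftBlock] <;> omega

lemma cnt_flatMap_rightBlock (l : List (Bool ⊕ T)) :
    cnt .S (l.flatMap rightBlock) = 0 ∧
    cnt .B (l.flatMap rightBlock) = 2 * cnt .A (l.flatMap rightBlock) := by
  induction l with
  | nil => simp
  | cons b l ih => rcases b with (_ | _) | _ <;> simp [rightBlock] <;> omega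

lemma cnt_leftStr (d : Conf T) :
    cnt .S d.leftStr = 0 ∧ cnt .B d.leftStr = 2 * cnt .A d.leftStr := by
  have := cnt_flatMap_leftBlock (T := T) d.left
  unfold leftStr
  split <;> simp <;> omega

lemma cnt_rightStr (d : Conf T) :
    cnt .S d.rightStr = 0 ∧ cnt .B d.rightStr = 2 * cnt .A d.rightStr := by
  have := cnt_flatMap_rightBlock d.right
  unfold rightStr
  split <;> simp <;> omega

lemma tm_notMem_leftStr (d : Conf T) (a : T) : GSym.tm a ∉ d.leftStr := by
  have : ∀ b, GSym.tm a ∉ (leftBlock b : Str N3 T) := by rintro (_ | _) <;> simp [leftBlock]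
  unfold leftStr
  split <;> simp [this]

lemma cnt_form_S (d : Conf T) : cnt .S d.form = 3 := by
  simp [form, (cnt_leftStr d).1, (cnt_rightStr d).1]

lemma cnt_form_AB (d : Conf T) : cnt .B d.form + 2 = 2 * cnt .A d.form := by
  have := (cnt_leftStr d).2
  have := (cnt_rightStr d).2
  simp [form]
  omega

lemma form_inj {d : Conf T} {a b c e : Str N3 T}
    (h : d.form = a ++ .nt .S :: (b ++ .nt .S :: (c ++ .nt .S :: e))) :
    a = [] ∧ b = d.leftStr ∧ c = d.rightStr ∧ e = d.out.map .tm ++ [.nt .A] := by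
  have hS := cnt_form_S d
  rw [h] at hS
  simp at hS
  obtain ⟨h₁, h₂⟩ := append_nt_inj (a := []) (n := .S) rfl (by omega) h
  obtain ⟨h₃, h₄⟩ := append_nt_inj (cnt_leftStr d).1 (by omega) h₂
  obtain ⟨h₅, h₆⟩ := append_nt_inj (cnt_rightStr d).1 (by omega) h₄
  exact ⟨h₁.symm, h₃.symm, h₅.symm, h₆.symm⟩

lemma leftStr_eq_cons {d : Conf T} {a b c : N3} {t : Str N3 T}
    (h : d.leftStr = .nt a :: .nt b :: .nt c :: t) :
    (d.markL = true ∧ a = .B ∧ b = .B ∧ c = .A ∧ t = d.left.flatMap leftBlock) ∨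
    (d.markL = false ∧ ∃ l, t = l.flatMap leftBlock ∧
      ((d.left = true :: l ∧ a = .A ∧ b = .B ∧ c = .B) ∨
        (d.left = false :: l ∧ a = .B ∧ b = .A ∧ c = .B))) := by
  obtain ⟨_ | _, _ | ⟨_ | _, l⟩, _, _, _⟩ := d <;>
    simp [leftStr, leftBlock] at h <;> obtain ⟨rfl, rfl, rfl, rfl⟩ := h <;> simp [leftBlock]

lemma rightStr_eq_append {d : Conf T} {a b c : N3} {t : Str N3 T} {w₁ w₂ w₃ : List T}
    (h : d.rightStr = t ++ .nt a :: (w₁.map .tm ++ .nt b :: (w₂.map .tm ++ .nt c :: w₃.map .tm))) :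
    (d.markR = true ∧ a = .A ∧ b = .B ∧ c = .B ∧ w₁ ++ w₂ ++ w₃ = [] ∧
      t = d.right.flatMap rightBlock) ∨
    (d.markR = false ∧ ∃ l, t = l.flatMap rightBlock ∧
      ((d.right = l ++ [.inl true] ∧ a = .B ∧ b = .B ∧ c = .A ∧ w₁ ++ w₂ ++ w₃ = []) ∨
        (d.right = l ++ [.inl false] ∧ a = .B ∧ b = .A ∧ c = .B ∧ w₁ ++ w₂ ++ w₃ = []) ∨
        ∃ x, d.right = l ++ [.inr x] ∧ a = .A ∧ b = .B ∧ c = .B ∧ w₁ ++ w₂ ++ w₃ = [x])) := by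
  have key : ∀ {a' b' c' : N3} {s : Str N3 T},
      s ++ [.nt a', .nt b', .nt c'] = t ++ .nt a ::
        (w₁.map .tm ++ .nt b :: (w₂.map .tm ++ .nt c :: w₃.map .tm)) →
      a = a' ∧ b = b' ∧ c = c' ∧ w₁ ++ w₂ ++ w₃ = [] ∧ t = s := by
    intro a' b' c' s h
    obtain ⟨rfl, rfl, h₂⟩ := append_nt_map_tm_eq_concat_nt (t := w₃) (m := c) (n := c')
      (u := t ++ .nt a :: (w₁.map .tm ++ .nt b :: w₂.map .tm)) (l := s ++ [.nt a', .nt b'])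
      (by simpa using h.symm)
    obtain ⟨rfl, rfl, h₁⟩ := append_nt_map_tm_eq_concat_nt (t := w₂) (m := b) (n := b')
      (u := t ++ .nt a :: w₁.map .tm) (l := s ++ [.nt a']) (by simpa using h₂)
    obtain ⟨rfl, rfl, rfl⟩ := append_nt_map_tm_eq_concat_nt h₁
    simp
  obtain ⟨k, l, r, m, o⟩ := d
  cases m with
  | true =>
    obtain ⟨rfl, rfl, rfl, h₁, rfl⟩ := key (by simpa [rightStr] using h)
    simp_all
  | false =>
    refine .inr ⟨rfl, ?_⟩
    induction r using List.reverseRecOn with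
    | nil => simp [rightStr] at h
    | append_singleton r x _ =>
      refine ⟨r, ?_⟩
      rcases x with (_ | _) | x
      · obtain ⟨rfl, rfl, rfl, h₁, rfl⟩ := key (by simpa [rightStr, rightBlock] using h)
        simp_all
      · obtain ⟨rfl, rfl, rfl, h₁, rfl⟩ := key (by simpa [rightStr, rightBlock] using h)
        simp_all
      · simp only [rightStr, List.flatMap_append, List.flatMap_singleton, rightBlock,
          Bool.false_eq_true, if_false, List.append_nil] at h
        obtain ⟨rfl, rfl, h₂⟩ := append_nt_map_tm_eq_concat_nt (t := w₃) (m := c) (n := .B)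
          (u := t ++ .nt a :: (w₁.map .tm ++ .nt b :: w₂.map .tm))
          (l := r.flatMap rightBlock ++ [.nt .A, .tm x, .nt .B])
          (by simpa using h.symm)
        obtain ⟨rfl, rfl, h₁⟩ := append_nt_map_tm_eq_concat_nt (t := w₂) (m := b) (n := .B)
          (u := t ++ .nt a :: w₁.map .tm) (l := r.flatMap rightBlock ++ [.nt .A, .tm x])
          (by simpa using h₂)
        obtain ⟨rfl, rfl, rfl⟩ := append_nt_map_tm_eq_concat_tm h₁
        simp

end Conf

end Configurations

section Productions

variable {T : Type}

/-- The common shape of the matching productions (4)–(7). -/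
def popRule (a b c d e f : N3) (o : Str N3 T) : List (N3 × Str N3 T) :=
  [(.S, []), (a, []), (b, []), (c, .nt .S :: o), (.S, [.nt .S]),
   (d, [.nt .S]), (e, []), (f, []), (.S, [])]

lemma exists_hstr_of_onAC {u : Str N5 T} (hu : OnAC u) :
    ∃ l : List Bool, hstr u = l.flatMap leftBlock := by
  induction u with
  | nil => exact ⟨[], rfl⟩
  | cons c u ih =>
    obtain ⟨l, hl⟩ := ih fun s hs => hu s (by simp [hs])
    rcases hu c (by simp) with rfl | rfl
    · exact ⟨true :: l, by simpa [hstr, hsym, leftBlock, nA, nB] using hl⟩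
    · exact ⟨false :: l, by simpa [hstr, hsym, leftBlock, nA, nB] using hl⟩

lemma exists_hstr_of_onBD {v : Str N5 T} (hv : OnBD v) :
    ∃ l : List (Bool ⊕ T), hstr v = l.flatMap rightBlock ∧ ∀ b ∈ l, b.isLeft := by
  induction v with
  | nil => exact ⟨[], by simp [hstr]⟩
  | cons c v ih =>
    obtain ⟨l, hl, hl'⟩ := ih fun s hs => hv s (by simp [hs])
    rcases hv c (by simp) with rfl | rfl
    · exact ⟨.inl true :: l, by simpa [hstr, hsym, rightBlock, nA, nB] using hl, by simpa using hl'⟩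
    · exact ⟨.inl false :: l, by simpa [hstr, hsym, rightBlock, nA, nB] using hl, by simpa using hl'⟩

lemma GeffertForm.exists_hstr {r : Str N5 T} (h : GeffertForm r) (hr : r ≠ []) :
    ∃ (l : List Bool) (g : List (Bool ⊕ T)),
      hstr r = l.flatMap leftBlock ++ .nt .S :: g.flatMap rightBlock ∧
      ((∃ a, g = [.inr a]) ∨ ∀ b ∈ g, b.isLeft) := by
  rcases h with ⟨u, a, hu, rfl⟩ | ⟨u, v, hu, hv, rfl⟩ | rfl
  · obtain ⟨l, hl⟩ := exists_hstr_of_onAC hu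
    refine ⟨l, [.inr a], ?_, .inl ⟨a, rfl⟩⟩
    simpa [hstr, hsym, rightBlock, nA, nB, nS] using hl
  · obtain ⟨l, hl⟩ := exists_hstr_of_onAC hu
    obtain ⟨g, hg, hg'⟩ := exists_hstr_of_onBD hv
    refine ⟨l, g, ?_, .inr hg'⟩
    rw [← hl, ← hg]
    simp [hstr, hsym, nS]
  · exact absurd rfl hr

lemma mainG_step_cases {P : List (Str N5 T)} (hP : ∀ r ∈ P, GeffertForm r) {x y : Str N3 T}
    (h : (mainG P).Step x y) :
    SCMatch p1 x y ∨ (∃ r, GeffertForm r ∧ r ≠ [] ∧ SCMatch (p23 r) x y) ∨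
      SCMatch (popRule .A .B .B .B .B .A []) x y ∨ SCMatch (popRule .B .A .B .B .A .B []) x y ∨
      SCMatch (popRule .B .B .A .A .B .B [.nt .B, .nt .B, .nt .A]) x y ∨
      SCMatch (popRule .B .B .A .A .B .B []) x y ∨ SCMatch p8 x y := by
  obtain ⟨p, hp, hm⟩ := h
  simp only [mainG, List.mem_cons, List.mem_append, List.mem_map, List.mem_filter,
    List.not_mem_nil, or_false] at hp
  rcases hp with rfl | ⟨r, ⟨hr, hne⟩, rfl⟩ | rfl | rfl | rfl | rfl | rfl
  · exact .inl hm
  · exact .inr (.inl ⟨r, hP r hr, by simpa using hne, hm⟩)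
  all_goals simp_all [p4, p5, p6, p7, popRule, nS, nA, nB]

lemma mainG_step_head {P : List (Str N5 T)} (hP : ∀ r ∈ P, GeffertForm r) {x y : Str N3 T}
    (h : (mainG P).Step x y) : ∃ a s t, x = a ++ .nt .S :: s ∧ y = a ++ t := by
  rcases mainG_step_cases hP h with h | ⟨r, -, -, h⟩ | h | h | h | h | h <;>
    obtain ⟨a, s, t, rfl, rfl, -⟩ := h <;> exact ⟨a, s, _, rfl, List.append_assoc ..⟩

lemma mainG_step_cnt {P : List (Str N5 T)} (hP : ∀ r ∈ P, GeffertForm r) {x y : Str N3 T}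
    (h : (mainG P).Step x y) :
    (2 * cnt .S y + 3 * cnt .B y + 6 * cnt .A x + 2 = 2 * cnt .S x + 3 * cnt .B x + 6 * cnt .A y) ∨
    (cnt .S y = cnt .S x ∧ cnt .B y + 2 * cnt .A x = cnt .B x + 2 * cnt .A y ∧
      ∃ p q s, x = p ++ .nt .S :: s ∧ y = q ++ s) ∨
    (cnt .S y + 3 = cnt .S x ∧ cnt .A y + 1 = cnt .A x ∧ cnt .B y = cnt .B x) := by
  rcases mainG_step_cases hP h with h | ⟨r, hr, hne, h⟩ | h | h | h | h | h
  · have hS := h.cnt_eq .S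
    have hA := h.cnt_eq .A
    have hB := h.cnt_eq .B
    simp [p1, nS, nA, nB] at hS hA hB
    omega
  · obtain ⟨l, g, hlg, -⟩ := hr.exists_hstr hne
    have hS := h.cnt_eq .S
    have hA := h.cnt_eq .A
    have hB := h.cnt_eq .B
    have hl := Conf.cnt_flatMap_leftBlock (T := T) l
    have hg := Conf.cnt_flatMap_rightBlock g
    simp [p23, nS, hlg] at hS hA hB
    exact .inr (.inl ⟨by omega, by omega, h.exists_suffix (ps := [_, _])⟩)
  iterate 4
    have hS := h.cnt_eq .S
    have hA := h.cnt_eq .A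
    have hB := h.cnt_eq .B
    simp [popRule] at hS hA hB
    exact .inr (.inl ⟨by omega, by omega, h.exists_suffix (ps := [_, _, _, _, _, _, _, _])⟩)
  · have hS := h.cnt_eq .S
    have hA := h.cnt_eq .A
    have hB := h.cnt_eq .B
    simp [p8] at hS hA hB
    omega

variable {P : List (Str N5 T)} {w : List T}

lemma cnt_le_of_derives (hP : ∀ r ∈ P, GeffertForm r) {x : Str N3 T}
    (h : Relation.ReflTransGen (mainG P).Step x (w.map .tm)) :
    6 * cnt .A x ≤ 2 * cnt .S x + 3 * cnt .B x := by
  induction h using Relation.ReflTransGen.head_induction_on with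
  | refl => simp
  | head h _ ih => rcases mainG_step_cnt hP h with h | h | h <;> omega

lemma not_step_of_cnt_eq_zero (hP : ∀ r ∈ P, GeffertForm r) {x y : Str N3 T}
    (hx : cnt .S x = 0) : ¬ (mainG P).Step x y := by
  intro h
  obtain ⟨a, s, t, rfl, -⟩ := mainG_step_head hP h
  simp at hx

/-- Material to the left of the first `S` is never rewritten. -/
lemma cnt_eq_zero_of_prefix (hP : ∀ r ∈ P, GeffertForm r) {a z : Str N3 T}
    (ha : cnt .S a = 0) (h : Relation.ReflTransGen (mainG P).Step (a ++ z) (w.map .tm)) (n : N3) :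
    cnt n a = 0 := by
  generalize hx : a ++ z = x at h
  induction h using Relation.ReflTransGen.head_induction_on generalizing z with
  | refl =>
    have := congrArg (cnt n) hx
    simp at this
    omega
  | head h _ ih =>
    obtain ⟨b, s, t, rfl, rfl⟩ := mainG_step_head hP h
    rcases List.append_eq_append_iff.1 hx with ⟨m, rfl, -⟩ | ⟨m, rfl, hm⟩
    · exact ih (z := m ++ t) (by simp)
    · cases m with
      | nil => exact ih (z := t) (by simp)
      | cons c m =>
        obtain ⟨rfl, -⟩ := List.cons.inj hm
        simp at ha

/-- Of the nonterminals to the right of the last `S`, at most a single `A` can be erased. -/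
lemma cnt_le_of_suffix (hP : ∀ r ∈ P, GeffertForm r) {z s : Str N3 T}
    (hs : cnt .S s = 0) (h₃ : cnt .S (z ++ s) = 3)
    (hAB : cnt .B (z ++ s) + 2 = 2 * cnt .A (z ++ s))
    (h : Relation.ReflTransGen (mainG P).Step (z ++ s) (w.map .tm)) :
    cnt .A s ≤ 1 ∧ cnt .B s = 0 := by
  generalize hx : z ++ s = x at h h₃ hAB
  induction h using Relation.ReflTransGen.head_induction_on generalizing z with
  | refl => simp at h₃
  | @head x y h hy ih =>
    rcases mainG_step_cnt hP h with hc | ⟨hS, hc, p, q, t, rfl, rfl⟩ | ⟨hS, hA, hB⟩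
    · have := cnt_le_of_derives hP hy
      omega
    · obtain ⟨m, rfl⟩ := exists_prefix_of_append_eq hs hx
      exact ih (z := q ++ m) (by simp) (by omega) (by omega)
    · subst hx
      have hz : ∀ n, cnt n y = 0 := by
        intro n
        rcases hy.cases_head with rfl | ⟨c, hc, -⟩
        · simp
        · exact absurd hc (not_step_of_cnt_eq_zero hP (by omega))
      have hzA := hz .A
      have hzB := hz .B
      simp at hA hB
      omega

namespace Conf

/-- Matching productions only consume adjacent blocks in successful derivations. -/
lemma pop_form (hP : ∀ r ∈ P, GeffertForm r) {d : Conf T} {y : Str N3 T} {a b c a' b' c' : N3}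
    {o : Str N3 T} (ho : cnt .S o = 0) (hstep : (mainG P).Step d.form y)
    (hm : SCMatch (popRule a b c a' b' c' o) d.form y)
    (hy : Relation.ReflTransGen (mainG P).Step y (w.map .tm)) :
    ∃ (l r : Str N3 T) (w₁ w₂ w₃ : List T), d.leftStr = .nt a :: .nt b :: .nt c :: l ∧
      d.rightStr = r ++ .nt a' :: (w₁.map .tm ++ .nt b' :: (w₂.map .tm ++ .nt c' :: w₃.map .tm)) ∧
      y = .nt .S :: (o ++ l ++ .nt .S :: (r ++ .nt .S :: ((w₁ ++ w₂ ++ w₃ ++ d.out).map .tm ++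
        [.nt .A]))) := by
  have h₃ := cnt_form_S d
  have hAB := cnt_form_AB d
  obtain ⟨u₁, _, _, hd, rfl, u₂, _, _, rfl, rfl, u₃, _, _, rfl, rfl, u₄, _, _, rfl, rfl,
    u₅, _, _, rfl, rfl, u₆, _, _, rfl, rfl, u₇, _, _, rfl, rfl, u₈, _, _, rfl, rfl,
    u₉, u₁₀, _, rfl, rfl, rfl⟩ := hm
  obtain ⟨rfl, hl, hr, rfl⟩ := form_inj (d := d) (a := u₁)
    (b := u₂ ++ .nt a :: (u₃ ++ .nt b :: (u₄ ++ .nt c :: u₅)))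
    (c := u₆ ++ .nt a' :: (u₇ ++ .nt b' :: (u₈ ++ .nt c' :: u₉))) (e := u₁₀) (by simpa using hd)
  have hlS := (cnt_leftStr d).1
  have hrS := (cnt_rightStr d).1
  rw [← hl] at hlS
  rw [← hr] at hrS
  simp at hlS hrS
  have hpre : ∀ n, cnt n (u₂ ++ u₃ ++ u₄) = 0 :=
    cnt_eq_zero_of_prefix hP (z := .nt .S :: (o ++ u₅ ++ .nt .S :: (u₆ ++ .nt .S ::
      (u₇ ++ u₈ ++ u₉ ++ (d.out.map .tm ++ [.nt .A]))))) (by simp; omega) (by simpa using hy)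
  have hnil : u₂ ++ u₃ ++ u₄ = [] := by
    obtain ⟨v, hv⟩ := exists_eq_map_tm hpre
    cases v with
    | nil => simpa using hv
    | cons t v =>
      exfalso
      refine tm_notMem_leftStr d t ?_
      have : GSym.tm t ∈ u₂ ++ u₃ ++ u₄ := by simp [hv]
      rw [← hl]
      simp at this ⊢
      tauto
  simp at hnil
  obtain ⟨rfl, rfl, rfl⟩ := hnil
  have hcy : cnt .S (.nt .S :: (o ++ u₅ ++ .nt .S :: (u₆ ++ [.nt .S])) ++
      (u₇ ++ u₈ ++ u₉ ++ (d.out.map .tm ++ [.nt .A]))) = 3 := by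
    simp; omega
  have hsuf := cnt_le_of_suffix hP (w := w)
    (z := .nt .S :: (o ++ u₅ ++ .nt .S :: (u₆ ++ [.nt .S])))
    (s := u₇ ++ u₈ ++ u₉ ++ (d.out.map .tm ++ [.nt .A])) (by simp; omega) hcy
    (by
      have := mainG_step_cnt hP hstep
      have := cnt_le_of_derives hP hy
      simp at *
      omega) (by simpa using hy)
  simp at hsuf
  obtain ⟨w₁, rfl⟩ := exists_eq_map_tm (x := u₇) (by rintro (_ | _ | _) <;> omega)
  obtain ⟨w₂, rfl⟩ := exists_eq_map_tm (x := u₈) (by rintro (_ | _ | _) <;> omega)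
  obtain ⟨w₃, rfl⟩ := exists_eq_map_tm (x := u₉) (by rintro (_ | _ | _) <;> omega)
  exact ⟨u₅, u₆, w₁, w₂, w₃, by simpa using hl.symm, hr.symm, by simp⟩

lemma step_form_of_mark (hP : ∀ r ∈ P, GeffertForm r) {d : Conf T} {y : Str N3 T} (k : Bool)
    {o : Str N3 T} (ho : o = if k then [.nt .B, .nt .B, .nt .A] else [])
    (hstep : (mainG P).Step d.form y)
    (h : SCMatch (popRule .B .B .A .A .B .B o) d.form y)
    (hy : Relation.ReflTransGen (mainG P).Step y (w.map .tm)) :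
    ∃ d' : Conf T, y = d'.form ∧ (d'.Live → d.Live) := by
  obtain ⟨_, _, w₁, w₂, w₃, hl, hr, rfl⟩ :=
    pop_form hP (by subst ho; cases k <;> rfl) hstep h hy
  have hl := leftStr_eq_cons hl
  have hr := rightStr_eq_append hr
  simp only [reduceCtorEq, false_and, and_false, or_false, false_or, true_and,
    exists_false] at hl hr
  obtain ⟨hL, rfl⟩ := hl
  rcases hr with ⟨hR, hw, rfl⟩ | ⟨hR, r, rfl, x, hr, hw⟩
  · refine ⟨⟨k, d.left, d.right, false, d.out⟩, by simp [form, leftStr, rightStr, ho, hw], ?_⟩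
    rintro ⟨h₁, -⟩
    exact ⟨h₁, by simp [hL]⟩
  · refine ⟨⟨k, d.left, r, false, x :: d.out⟩, by simp [form, leftStr, rightStr, ho, hw], ?_⟩
    rintro ⟨h₁, -⟩
    refine ⟨?_, by simp [hL]⟩
    rw [hr, List.pairwise_append]
    exact ⟨h₁, by simp, by simp⟩

lemma step_form (hP : ∀ r ∈ P, GeffertForm r) {d : Conf T} {y : Str N3 T}
    (hstep : (mainG P).Step d.form y)
    (hy : Relation.ReflTransGen (mainG P).Step y (w.map .tm)) :
    (cnt .S y = 0 ∧ d.Live) ∨ ∃ d' : Conf T, y = d'.form ∧ (d'.Live → d.Live) := by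
  have h₃ := cnt_form_S d
  have hAB := cnt_form_AB d
  rcases mainG_step_cases hP hstep with h | ⟨r, hr, hne, h⟩ | h | h | h | h | h
  · have hS := h.cnt_eq .S
    have hA := h.cnt_eq .A
    have hB := h.cnt_eq .B
    have := cnt_le_of_derives hP hy
    simp [p1, nS, nA, nB] at hS hA hB
    omega
  · obtain ⟨l, g, hlg, hg⟩ := hr.exists_hstr hne
    obtain ⟨u₁, _, _, hd, rfl, u₂, _, _, rfl, rfl, u₃, u₄, _, rfl, rfl, rfl⟩ := h
    obtain ⟨rfl, rfl, rfl, rfl⟩ := form_inj hd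
    refine .inr ⟨⟨d.markL, d.left ++ l, g ++ d.right, d.markR, d.out⟩, ?_, ?_⟩
    · simp [form, leftStr, rightStr, nS, hlg]
    · rintro ⟨h₁, h₂⟩
      rw [List.pairwise_append] at h₁
      exact ⟨h₁.2.1, fun hk => ⟨fun b hb => (h₂ hk).1 b (by simp [hb]), (h₂ hk).2⟩⟩
  · obtain ⟨_, _, w₁, w₂, w₃, hl, hr, rfl⟩ := pop_form hP rfl hstep h hy
    have hl := leftStr_eq_cons hl
    have hr := rightStr_eq_append hr
    simp only [reduceCtorEq, false_and, and_false, or_false, false_or, true_and,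
      and_true, exists_false] at hl hr
    obtain ⟨hL, l, rfl, hl⟩ := hl
    obtain ⟨hR, r, rfl, hr, hw⟩ := hr
    refine .inr ⟨⟨false, l, r, false, d.out⟩, by simp [form, leftStr, rightStr, hw], ?_⟩
    rintro ⟨h₁, h₂⟩
    refine ⟨?_, fun _ => ⟨?_, hR⟩⟩ <;> grind
  · obtain ⟨_, _, w₁, w₂, w₃, hl, hr, rfl⟩ := pop_form hP rfl hstep h hy
    have hl := leftStr_eq_cons hl
    have hr := rightStr_eq_append hr
    simp only [reduceCtorEq, false_and, and_false, or_false, false_or, true_and,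
      and_true, exists_false] at hl hr
    obtain ⟨hL, l, rfl, hl⟩ := hl
    obtain ⟨hR, r, rfl, hr, hw⟩ := hr
    refine .inr ⟨⟨false, l, r, false, d.out⟩, by simp [form, leftStr, rightStr, hw], ?_⟩
    rintro ⟨h₁, h₂⟩
    refine ⟨?_, fun _ => ⟨?_, hR⟩⟩ <;> grind
  · exact .inr (step_form_of_mark hP true rfl hstep h hy)
  · exact .inr (step_form_of_mark hP false rfl hstep h hy)
  · obtain ⟨u₁, _, _, hd, rfl, u₂, _, _, rfl, rfl, u₃, _, _, rfl, rfl,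
      u₄, u₅, _, rfl, rfl, rfl⟩ := h
    left
    obtain ⟨rfl, rfl, rfl, he⟩ := form_inj hd
    have hS : cnt .S (u₄ ++ u₅) = 0 := by
      have := congrArg (cnt .S) he
      simpa using this
    have hlS := (cnt_leftStr d).1
    have hrS := (cnt_rightStr d).1
    have hy0 : ∀ n, cnt n ([] ++ [] ++ (d.leftStr ++ [] ++ (d.rightStr ++ [] ++
        (u₄ ++ [] ++ u₅)))) = 0 := by
      intro n
      rcases hy.cases_head with hy | ⟨c, hc, -⟩
      · rw [hy]; simp
      · refine absurd hc (not_step_of_cnt_eq_zero hP ?_)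
        simp at hS ⊢
        omega
    refine ⟨hy0 _, ?_⟩
    have hr : ∀ n, cnt n d.rightStr = 0 := fun n => by
      have := hy0 n
      simp at this
      omega
    have hR : d.markR = false := by
      have := hr .A
      by_contra hR
      simp [rightStr, Bool.eq_true_of_not_eq_false hR] at this
    have hg : d.right = [] := by
      have := hr .A
      cases hg : d.right with
      | nil => rfl
      | cons b l => rcases b with (_ | _) | _ <;> simp [rightStr, hg, rightBlock] at this
    simp [Live, hg, hR]

lemma live_of_derives (hP : ∀ r ∈ P, GeffertForm r) {d : Conf T}
    (h : Relation.ReflTransGen (mainG P).Step d.form (w.map .tm)) : d.Live := by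
  generalize hx : d.form = x at h
  induction h using Relation.ReflTransGen.head_induction_on generalizing d with
  | refl => simpa [hx] using cnt_form_S d
  | head h hy ih =>
    subst hx
    rcases step_form hP h hy with ⟨-, hd⟩ | ⟨d', rfl, hd⟩
    · exact hd
    · exact hd (ih rfl)

lemma exists_form_of_derives (hP : ∀ r ∈ P, GeffertForm r) {x : Str N3 T}
    (h₁ : Relation.TransGen (mainG P).Step [.nt .S] x)
    (h₂ : Relation.TransGen (mainG P).Step x (w.map .tm)) : ∃ d : Conf T, x = d.form := by
  induction h₁ with
  | single h =>
    rcases mainG_step_cases hP h with h | ⟨r, -, -, h⟩ | h | h | h | h | h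
    · obtain ⟨u₁, u₂, _, hS, rfl, rfl⟩ := h
      obtain ⟨rfl, rfl⟩ : u₁ = [] ∧ u₂ = [] := by
        cases u₁ <;> simp_all
      exact ⟨⟨true, [], [], true, []⟩, by simp [form, leftStr, rightStr, nS, nA, nB]⟩
    · have := h.cnt_le .S
      simp [p23] at this
    iterate 4
      have := h.cnt_le .S
      simp [popRule] at this
    · have := h.cnt_le .S
      simp [p8] at this
  | tail _ h ih =>
    obtain ⟨d, rfl⟩ := ih (.head h h₂)
    rcases step_form hP h h₂.to_reflTransGen with ⟨h₀, -⟩ | ⟨d', rfl, -⟩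
    · obtain ⟨c, hc, -⟩ := Relation.TransGen.head'_iff.1 h₂
      exact absurd hc (not_step_of_cnt_eq_zero hP h₀)
    · exact ⟨d', rfl⟩

lemma Live.exists_right_eq {d : Conf T} (h : d.Live) :
    ∃ (q : List Bool) (r : List T), d.right = q.map .inl ++ r.map .inr := by
  have h := h.1
  generalize d.right = g at h
  induction g with
  | nil => exact ⟨[], [], rfl⟩
  | cons b g ih =>
    obtain ⟨hb, hg⟩ := List.pairwise_cons.1 h
    obtain ⟨q, r, rfl⟩ := ih hg
    rcases b with b | a
    · exact ⟨b :: q, r, rfl⟩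
    · cases q with
      | nil => exact ⟨[], a :: r, rfl⟩
      | cons c q => simpa using hb (.inl c) (by simp)

end Conf

end Productions

open GSym in
/-- Every inner sentential form of a successful derivation of the constructed
grammar (strictly after the first step and strictly before the last) has the form
S ū S v̄ S w̄ A with ū ∈ (BBA+λ){ABB,BAB}*, v̄ ∈ {BBA,BAB}*{AaBB : a∈T}*(ABB+λ),
and w̄ ∈ T*. -/
theorem inner_sentential_forms {T : Type} (P : List (Str N5 T))
    (hP : ∀ r ∈ P, GeffertForm r)
    (w : List T) (x : Str N3 T)
    (h₁ : Relation.TransGen (mainG P).Step [nt N3.S] x)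
    (h₂ : Relation.TransGen (mainG P).Step x (w.map tm)) :
    ∃ u v : Str N3 T, ∃ wt : List T,
      x = [nS] ++ u ++ [nS] ++ v ++ [nS] ++ wt.map tm ++ [nA] ∧
      (∃ pre rest : Str N3 T,
        (pre = [] ∨ pre = [nB, nB, nA]) ∧
        InStar {[nA, nB, nB], [nB, nA, nB]} rest ∧ u = pre ++ rest) ∧
      (∃ q r s : Str N3 T,
        InStar {[nB, nB, nA], [nB, nA, nB]} q ∧
        InStar {z : Str N3 T | ∃ a : T, z = [nA, tm a, nB, nB]} r ∧
        (s = [] ∨ s = [nA, nB, nB]) ∧ v = q ++ r ++ s) := by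
  obtain ⟨d, rfl⟩ := Conf.exists_form_of_derives hP h₁ h₂
  obtain ⟨q, r, hqr⟩ := (Conf.live_of_derives hP h₂.to_reflTransGen).exists_right_eq
  refine ⟨d.leftStr, d.rightStr, d.out, by simp [Conf.form, nS, nA],
    ⟨_, _, ?_, ⟨d.left.map leftBlock, ?_, rfl⟩, by rw [← List.flatMap_def]; rfl⟩,
    ⟨(q.map .inl).flatMap rightBlock, (r.map .inr).flatMap rightBlock,
      if d.markR then [nA, nB, nB] else [],
      ⟨_, ?_, List.flatMap_def⟩, ⟨_, ?_, List.flatMap_def⟩, ?_, ?_⟩⟩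
  · cases d.markL <;> simp [nA, nB]
  · rintro p hp
    obtain ⟨b, -, rfl⟩ := List.mem_map.1 hp
    cases b <;> simp [leftBlock, nA, nB]
  · rintro p hp
    simp only [List.mem_map] at hp
    obtain ⟨_, ⟨b, -, rfl⟩, rfl⟩ := hp
    cases b <;> simp [rightBlock, nA, nB]
  · rintro p hp
    simp only [List.mem_map] at hp
    obtain ⟨_, ⟨a, -, rfl⟩, rfl⟩ := hp
    exact ⟨a, rfl⟩
  · cases d.markR <;> simp
  · rw [Conf.rightStr, hqr, List.flatMap_append]; rfl
end
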